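/- Let {L₁,…,L₆} be a real Schläfli six, i.e., six pairwise skew lines in RP³ lying on a nonsingular cubic surface, and suppose that every 5-element subconfiguration {L₁,…,L₆}∖{Lᵢ} has signature of absolute value 4 (the bipartite case). Then the configuration {L₁,…,L₆} is deformation equivalent to the join configuration J(123654). -/

import Mathlib

open Submodule

abbrev V4 : Type := Fin 4 → ℝ

abbrev PLine : Type := Submodule ℝ V4

def IsLine (P : PLine) : Prop := Module.finrank ℝ P = 2

def Skew (P Q : PLine) : Prop := IsLine P ∧ IsLine Q ∧ P ⊓ Q = ⊥

def PairwiseSkew {n : ℕ} (L : Fin n → PLine) : Prop :=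
  ∀ i j : Fin n, i ≠ j → Skew (L i) (L j)

noncomputable def det2 (a b c d : V4) : ℝ := Matrix.det (Matrix.of ![a, b, c, d])

open Classical in
noncomputable def lk (P Q R : PLine) : ℝ :=
  if h : ∃ v : Fin 6 → V4,
      P = span ℝ {v 0, v 1} ∧ Q = span ℝ {v 2, v 3} ∧ R = span ℝ {v 4, v 5} then
    Real.sign (det2 (h.choose 0) (h.choose 1) (h.choose 2) (h.choose 3) *
      det2 (h.choose 0) (h.choose 1) (h.choose 4) (h.choose 5) *
      det2 (h.choose 2) (h.choose 3) (h.choose 4) (h.choose 5))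
  else 0

noncomputable def sgnOf {n : ℕ} (L : Fin n → PLine) : ℝ :=
  ∑ i : Fin n, ∑ j : Fin n, ∑ k : Fin n,
    if i < j ∧ j < k then lk (L i) (L j) (L k) else 0

def ContinuousLineFamily (L : ℝ → PLine) : Prop :=
  ∃ v w : ℝ → V4, ContinuousOn v (Set.Icc 0 1) ∧ ContinuousOn w (Set.Icc 0 1) ∧
    ∀ t ∈ Set.Icc (0:ℝ) 1, L t = span ℝ {v t, w t}

def Deformation {n : ℕ} (L L' : Fin n → PLine) : Prop :=
  ∃ F : ℝ → Fin n → PLine,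
    (∀ i, ContinuousLineFamily (fun t => F t i)) ∧
    (∀ t ∈ Set.Icc (0:ℝ) 1, PairwiseSkew (F t)) ∧
    F 0 = L ∧ F 1 = L'

def DeformEquiv {n : ℕ} (L L' : Fin n → PLine) : Prop :=
  ∃ π π' : Equiv.Perm (Fin n), Deformation (L ∘ π) (L' ∘ π')

def IsMirror {n : ℕ} (L L' : Fin n → PLine) : Prop :=
  ∃ A : V4 →ₗ[ℝ] V4, LinearMap.det A < 0 ∧ ∀ i, L' i = (L i).map A

def CoarseDeformEquiv {n : ℕ} (L L' : Fin n → PLine) : Prop :=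
  DeformEquiv L L' ∨ ∃ M : Fin n → PLine, IsMirror L' M ∧ DeformEquiv L M

noncomputable def joinConfig {n : ℕ} (σ : Equiv.Perm (Fin n)) : Fin n → PLine :=
  fun i => span ℝ {![1, (i.val : ℝ) + 1, 0, 0], ![0, 0, ((σ i).val : ℝ) + 1, 1]}

def IsSchlafliSix (L : Fin 6 → PLine) : Prop :=
  PairwiseSkew L ∧
  ∃ F : MvPolynomial (Fin 4) ℝ,
    F ≠ 0 ∧ F.IsHomogeneous 3 ∧
    (∀ i : Fin 6, ∀ x ∈ L i, MvPolynomial.eval x F = 0) ∧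
    (∀ z : Fin 4 → ℂ, z ≠ 0 →
      MvPolynomial.eval z (MvPolynomial.map (algebraMap ℝ ℂ) F) = 0 →
      ∃ j : Fin 4, MvPolynomial.eval z (MvPolynomial.map (algebraMap ℝ ℂ) (MvPolynomial.pderiv j F)) ≠ 0)

def Reducible {n : ℕ} (L : Fin n → PLine) : Prop :=
  ∃ i j : Fin n, i ≠ j ∧ ∃ F : ℝ → Fin n → PLine,
    (∀ k, ContinuousLineFamily (fun t => F t k)) ∧
    F 0 = L ∧
    (∀ t ∈ Set.Ico (0:ℝ) 1, PairwiseSkew (F t)) ∧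
    F 1 i = F 1 j ∧
    (∀ k l : Fin n, k ≠ l → ¬(k = i ∧ l = j) → ¬(k = j ∧ l = i) → Skew (F 1 k) (F 1 l))

theorem det2_eq (a b c d : V4) : det2 a b c d =
    (a 0 * b 1 - a 1 * b 0) * (c 2 * d 3 - c 3 * d 2)
    - (a 0 * b 2 - a 2 * b 0) * (c 1 * d 3 - c 3 * d 1)
    + (a 0 * b 3 - a 3 * b 0) * (c 1 * d 2 - c 2 * d 1)
    + (a 1 * b 2 - a 2 * b 1) * (c 0 * d 3 - c 3 * d 0)
    - (a 1 * b 3 - a 3 * b 1) * (c 0 * d 2 - c 2 * d 0)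
    + (a 2 * b 3 - a 3 * b 2) * (c 0 * d 1 - c 1 * d 0) := by
  simp [det2, Matrix.det_succ_row_zero, Fin.sum_univ_succ, Fin.succAbove]
  ring

/-- Six lines in projective space, each given by a pair of spanning vectors. -/
abbrev Frames : Type := Fin 6 → V4 × V4

noncomputable def frameDet (f : Frames) (i j : Fin 6) : ℝ :=
  det2 (f i).1 (f i).2 (f j).1 (f j).2

def skewFrames : Set Frames := {f | ∀ i j, i ≠ j → frameDet f i j ≠ 0}

def frameLines (f : Frames) : Fin 6 → PLine := fun i => span ℝ {(f i).1, (f i).2}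

def rescale (c d : Fin 6 → ℝ) (f : Frames) : Frames := fun i => (c i • (f i).1, d i • (f i).2)

/-- Equivalence of frames up to deformation, reordering and rescaling of the spanning vectors. -/
def FrameEquiv (f g : Frames) : Prop :=
  ∃ (π : Equiv.Perm (Fin 6)) (c d : Fin 6 → ℝ), (∀ i, c i ≠ 0) ∧ (∀ i, d i ≠ 0) ∧
    JoinedIn skewFrames f (rescale c d (g ∘ π))

theorem frameDet_symm (f : Frames) (i j : Fin 6) : frameDet f i j = frameDet f j i := by
  simp only [frameDet, det2_eq]; ring

theorem frameDet_self (f : Frames) (i : Fin 6) : frameDet f i i = 0 := by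
  simp only [frameDet, det2_eq]; ring

theorem frameDet_rescale (c d : Fin 6 → ℝ) (f : Frames) (i j : Fin 6) :
    frameDet (rescale c d f) i j = c i * d i * (c j * d j) * frameDet f i j := by
  simp only [frameDet, det2_eq, rescale, Pi.smul_apply, smul_eq_mul]; ring

theorem frameDet_comp (f : Frames) (π : Equiv.Perm (Fin 6)) (i j : Fin 6) :
    frameDet (f ∘ π) i j = frameDet f (π i) (π j) := rfl

theorem continuous_frameDet (i j : Fin 6) : Continuous fun f : Frames => frameDet f i j := by
  simp only [frameDet, det2_eq]
  fun_prop

theorem continuous_rescale_comp (c d : Fin 6 → ℝ) (π : Equiv.Perm (Fin 6)) :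
    Continuous fun f : Frames => rescale c d (f ∘ π) := by
  unfold rescale
  simp only [Function.comp_apply]
  fun_prop

theorem rescale_comp_mem {c d : Fin 6 → ℝ} (hc : ∀ i, c i ≠ 0) (hd : ∀ i, d i ≠ 0)
    (π : Equiv.Perm (Fin 6)) {f : Frames} (hf : f ∈ skewFrames) :
    rescale c d (f ∘ π) ∈ skewFrames := by
  intro i j hij
  rw [frameDet_rescale, frameDet_comp]
  exact mul_ne_zero (mul_ne_zero (mul_ne_zero (hc i) (hd i)) (mul_ne_zero (hc j) (hd j)))
    (hf _ _ (π.injective.ne hij))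

theorem JoinedIn.rescale_comp {c d : Fin 6 → ℝ} (hc : ∀ i, c i ≠ 0) (hd : ∀ i, d i ≠ 0)
    (π : Equiv.Perm (Fin 6)) {f g : Frames} (h : JoinedIn skewFrames f g) :
    JoinedIn skewFrames (rescale c d (f ∘ π)) (rescale c d (g ∘ π)) := by
  refine (h.map (continuous_rescale_comp c d π)).mono ?_
  rintro _ ⟨f, hf, rfl⟩
  exact rescale_comp_mem hc hd π hf

theorem rescale_one (f : Frames) : rescale 1 1 f = f := by
  funext i; simp [rescale]

theorem FrameEquiv.of_joinedIn {f g : Frames} (h : JoinedIn skewFrames f g) : FrameEquiv f g :=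
  ⟨1, 1, 1, by simp, by simp, by rw [rescale_one]; exact h⟩

theorem FrameEquiv.trans {f g h : Frames} (hfg : FrameEquiv f g) (hgh : FrameEquiv g h) :
    FrameEquiv f h := by
  obtain ⟨π, c, d, hc, hd, hj⟩ := hfg
  obtain ⟨ρ, c', d', hc', hd', hj'⟩ := hgh
  refine ⟨ρ * π, fun i => c i * c' (π i), fun i => d i * d' (π i),
    fun i => mul_ne_zero (hc i) (hc' _), fun i => mul_ne_zero (hd i) (hd' _),
    hj.trans ?_⟩
  convert hj'.rescale_comp hc hd π using 1
  funext i
  simp [rescale, mul_smul]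

theorem FrameEquiv.of_rescale_comp {f g : Frames} (hf : f ∈ skewFrames) {c d : Fin 6 → ℝ}
    (hc : ∀ i, c i ≠ 0) (hd : ∀ i, d i ≠ 0) (π : Equiv.Perm (Fin 6))
    (h : f = rescale c d (g ∘ π)) : FrameEquiv f g :=
  ⟨π, c, d, hc, hd, h ▸ JoinedIn.refl hf⟩

theorem FrameEquiv.of_comp {f g : Frames} (hf : f ∈ skewFrames) (π : Equiv.Perm (Fin 6))
    (h : f = g ∘ π) : FrameEquiv f g :=
  .of_rescale_comp hf (c := 1) (d := 1) (by simp) (by simp) π (by rw [rescale_one]; exact h)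

/-- A segment of frames along which all determinants are affine functions not changing sign
joins its end points. -/
theorem joinedIn_of_affine {f g : Frames}
    (haff : ∀ i j, i < j → ∀ t : ℝ, frameDet (fun i => (1 - t) • f i + t • g i) i j =
      (1 - t) * frameDet f i j + t * frameDet g i j)
    (hpos : ∀ i j, i < j → 0 < frameDet f i j * frameDet g i j) :
    JoinedIn skewFrames f g := by
  refine JoinedIn.ofLine (f := fun t i => (1 - t) • f i + t • g i) (by fun_prop)
    (by simp) (by simp) ?_
  rintro _ ⟨t, ⟨ht0, ht1⟩, rfl⟩
  have key : ∀ i j, i < j → frameDet (fun i => (1 - t) • f i + t • g i) i j ≠ 0 := by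
    intro i j hij
    rw [haff i j hij]
    have h := hpos i j hij
    intro h0
    rcases pos_and_pos_or_neg_and_neg_of_mul_pos h with ⟨h1, h2⟩ | ⟨h1, h2⟩
    · rcases eq_or_lt_of_le ht0 with rfl | ht
      · simp at h0; exact h1.ne' h0
      · nlinarith [mul_pos ht h2, mul_nonneg (sub_nonneg.2 ht1) h1.le]
    · rcases eq_or_lt_of_le ht0 with rfl | ht
      · simp at h0; exact h1.ne h0
      · nlinarith [mul_pos ht (neg_pos.2 h2), mul_nonneg (sub_nonneg.2 ht1) (neg_pos.2 h1).le]
  intro i j hij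
  rcases lt_or_gt_of_ne hij with h | h
  · exact key i j h
  · rw [frameDet_symm]; exact key j i h

theorem isOpen_skewFrames : IsOpen skewFrames := by
  simp only [skewFrames, Set.ofPred_forall]
  refine isOpen_iInter_of_finite fun i => isOpen_iInter_of_finite fun j =>
    isOpen_iInter_of_finite fun _ => ?_
  exact isOpen_ne_fun (continuous_frameDet i j) continuous_const

theorem eventually_joinedIn_skewFrames {f : Frames} (hf : f ∈ skewFrames) :
    ∀ᶠ g in nhds f, JoinedIn skewFrames f g := by
  obtain ⟨r, hr, hb⟩ := Metric.isOpen_iff.1 isOpen_skewFrames f hf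
  filter_upwards [Metric.ball_mem_nhds f hr] with g hg
  have hconv : IsPathConnected (Metric.ball f r) :=
    (convex_ball f r).isPathConnected ⟨f, Metric.mem_ball_self hr⟩
  exact (hconv.joinedIn f (Metric.mem_ball_self hr) g hg).mono hb

noncomputable def frameSign (f : Frames) (i j : Fin 6) : ℤ := SignType.sign (frameDet f i j)

/-- The signature condition on five-element subsets, in terms of a symmetric sign matrix;
every triple is counted six times. -/
def BipartiteSigns (e : Fin 6 → Fin 6 → ℤ) : Prop :=
  ∀ m, |∑ i, ∑ j, ∑ k, if i = m ∨ j = m ∨ k = m then 0 else e i j * e j k * e i k| = 24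

theorem BipartiteSigns.comp {e : Fin 6 → Fin 6 → ℤ} (π : Equiv.Perm (Fin 6))
    (h : BipartiteSigns e) : BipartiteSigns fun i j => e (π i) (π j) := by
  intro m
  rw [← h (π m)]
  congr 1
  refine Eq.trans (Finset.sum_congr rfl fun i _ => ?_) (Equiv.sum_comp π _)
  refine Eq.trans (Finset.sum_congr rfl fun j _ => ?_) (Equiv.sum_comp π _)
  refine Eq.trans (Finset.sum_congr rfl fun k _ => ?_) (Equiv.sum_comp π _)
  simp

theorem BipartiteSigns.of_switch {e e' : Fin 6 → Fin 6 → ℤ} (η : Fin 6 → ℤ)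
    (hη : ∀ i, η i * η i = 1) (he : ∀ i j, e' i j = η i * η j * e i j)
    (h : BipartiteSigns e) : BipartiteSigns e' := by
  intro m
  rw [← h m]
  congr 1
  refine Finset.sum_congr rfl fun i _ => Finset.sum_congr rfl fun j _ =>
    Finset.sum_congr rfl fun k _ => ?_
  split_ifs
  · rfl
  · rw [he, he, he]
    linear_combination (e i j * e j k * e i k) * ((η j * η j * η k * η k) * hη i +
      (η k * η k) * hη j + hη k)

theorem sign_cast_mul_self {x : ℝ} (hx : x ≠ 0) :
    (SignType.sign x : ℤ) * (SignType.sign x : ℤ) = 1 := by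
  rcases lt_or_gt_of_ne hx with h | h <;> simp [h]

theorem JoinedIn.frameSign_eq {f g : Frames} (h : JoinedIn skewFrames f g) :
    frameSign f = frameSign g := by
  obtain ⟨γ, hγ⟩ := h
  funext i j
  by_cases hij : i = j
  · subst hij; simp [frameSign, frameDet_self]
  have hc : Continuous fun t => frameDet (γ t) i j := (continuous_frameDet i j).comp γ.continuous
  have hne : (0 : ℝ) ∉ Set.range fun t => frameDet (γ t) i j := by
    rintro ⟨t, ht⟩; exact hγ t i j hij ht
  have h0 := hγ 0 i j hij
  have h1 := hγ 1 i j hij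
  rw [γ.source] at h0
  rw [γ.target] at h1
  unfold frameSign
  rcases lt_or_gt_of_ne h0 with a | a <;> rcases lt_or_gt_of_ne h1 with b | b
  · simp [a, b]
  · exact (hne (mem_range_of_exists_le_of_exists_ge hc ⟨0, by simpa using a.le⟩
      ⟨1, by simpa using b.le⟩)).elim
  · exact (hne (mem_range_of_exists_le_of_exists_ge hc ⟨1, by simpa using b.le⟩
      ⟨0, by simpa using a.le⟩)).elim
  · simp [a, b]

theorem FrameEquiv.bipartiteSigns {f g : Frames} (h : FrameEquiv f g)
    (hf : BipartiteSigns (frameSign f)) : BipartiteSigns (frameSign g) := by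
  obtain ⟨π, c, d, hc, hd, hj⟩ := h
  rw [hj.frameSign_eq] at hf
  have h2 : BipartiteSigns (frameSign (g ∘ π)) := by
    refine hf.of_switch (fun i => SignType.sign (c i * d i))
      (fun i => sign_cast_mul_self (mul_ne_zero (hc i) (hd i))) fun i j => ?_
    have h1 := sign_cast_mul_self (mul_ne_zero (hc i) (hd i))
    have h2 := sign_cast_mul_self (mul_ne_zero (hc j) (hd j))
    simp only [frameSign, frameDet_rescale]
    rw [_root_.sign_mul (c i * d i * (c j * d j)), _root_.sign_mul (c i * d i)]
    push_cast
    generalize (SignType.sign (c i * d i) : ℤ) = a at *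
    generalize (SignType.sign (c j * d j) : ℤ) = b at *
    generalize (SignType.sign (frameDet (g ∘ π) i j) : ℤ) = z at *
    linear_combination (-z) * (b * b * h1 + h2)
  have h3 := h2.comp π.symm
  have h4 : (fun i j => frameSign (g ∘ π) (π.symm i) (π.symm j)) = frameSign g := by
    funext i j; simp [frameSign, frameDet_comp]
  rwa [h4] at h3

theorem FrameEquiv.right_mem {f g : Frames} (h : FrameEquiv f g) : g ∈ skewFrames := by
  obtain ⟨π, c, d, hc, hd, hj⟩ := h
  intro i j hij h0
  refine hj.target_mem (π.symm i) (π.symm j) (π.symm.injective.ne hij) ?_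
  rw [frameDet_rescale, frameDet_comp]
  simp [h0]

noncomputable def joinFrames (α β : Fin 6 → ℝ) : Frames :=
  fun i => (![1, α i, 0, 0], ![0, 0, β i, 1])

theorem frameDet_joinFrames (α β : Fin 6 → ℝ) (i j : Fin 6) :
    frameDet (joinFrames α β) i j = (α j - α i) * (β j - β i) := by
  simp [frameDet, det2_eq, joinFrames]; ring

theorem joinFrames_mem {α β : Fin 6 → ℝ} (hα : α.Injective) (hβ : β.Injective) :
    joinFrames α β ∈ skewFrames := by
  intro i j hij
  rw [frameDet_joinFrames]
  exact mul_ne_zero (sub_ne_zero.2 (hα.ne hij.symm)) (sub_ne_zero.2 (hβ.ne hij.symm))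

theorem injective_of_joinFrames_mem {α β : Fin 6 → ℝ} (h : joinFrames α β ∈ skewFrames) :
    α.Injective ∧ β.Injective := by
  constructor <;> intro i j hij <;> by_contra hne <;> apply h i j hne <;>
    simp [frameDet_joinFrames, hij]

theorem joinFrames_equiv_of_order {α β α' β' : Fin 6 → ℝ}
    (hα : ∀ i j, i < j → 0 < (α j - α i) * (α' j - α' i))
    (hβ : ∀ i j, i < j → 0 < (β j - β i) * (β' j - β' i)) :
    FrameEquiv (joinFrames α β) (joinFrames α' β') := by
  have sq : ∀ {x y : ℝ}, 0 < x * y → 0 < x * x := fun {x y} h =>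
    mul_self_pos.2 (left_ne_zero_of_mul h.ne')
  have sq' : ∀ {x y : ℝ}, 0 < x * y → 0 < y * y := fun {x y} h =>
    mul_self_pos.2 (right_ne_zero_of_mul h.ne')
  have h1 : JoinedIn skewFrames (joinFrames α β) (joinFrames α' β) := by
    refine joinedIn_of_affine (fun i j _ t => ?_) fun i j hij => ?_
    · simp [frameDet, det2_eq, joinFrames]; ring
    · rw [frameDet_joinFrames, frameDet_joinFrames]
      linarith [mul_pos (hα i j hij) (sq (hβ i j hij))]
  have h2 : JoinedIn skewFrames (joinFrames α' β) (joinFrames α' β') := by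
    refine joinedIn_of_affine (fun i j _ t => ?_) fun i j hij => ?_
    · simp [frameDet, det2_eq, joinFrames]; ring
    · rw [frameDet_joinFrames, frameDet_joinFrames]
      linarith [mul_pos (hβ i j hij) (sq' (hα i j hij))]
  exact .of_joinedIn (h1.trans h2)

/-- Moving the point `α m` through infinity to the other end of the projective line. -/
theorem joinFrames_equiv_update_left {α β : Fin 6 → ℝ} (hα : α.Injective) (hβ : β.Injective)
    (m : Fin 6) (a : ℝ) (ha : ∀ j, j ≠ m → (α j - α m) * (α j - a) < 0) :
    FrameEquiv (joinFrames α β) (joinFrames (Function.update α m a) β) := by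
  refine ⟨1, Function.update 1 m (-1), 1, fun i => ?_, by simp, ?_⟩
  · by_cases h : i = m <;> simp [h]
  refine joinedIn_of_affine (fun i j hij t => ?_) fun i j hij => ?_
  · by_cases hi : i = m
    · subst hi
      simp [frameDet, det2_eq, joinFrames, rescale, hij.ne']; ring
    · by_cases hj : j = m
      · subst hj
        simp [frameDet, det2_eq, joinFrames, rescale, hij.ne]; ring
      · simp [frameDet, det2_eq, joinFrames, rescale, hi, hj]; ring
  · rw [frameDet_rescale, Equiv.Perm.coe_one, Function.comp_id, frameDet_joinFrames,
      frameDet_joinFrames]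
    have hb : 0 < (β j - β i) * (β j - β i) := mul_self_pos.2 (sub_ne_zero.2 (hβ.ne hij.ne'))
    by_cases hi : i = m
    · subst hi
      simp [hij.ne']
      linarith [mul_pos (neg_pos.2 (ha j hij.ne')) hb]
    · by_cases hj : j = m
      · subst hj
        simp [hij.ne]
        linarith [mul_pos (neg_pos.2 (ha i hij.ne)) hb]
      · simp [hi, hj]
        exact ⟨sub_ne_zero.2 (hα.ne hij.ne'), sub_ne_zero.2 (hβ.ne hij.ne')⟩

/-- Moving the point `β m` through infinity to the other end of the projective line. -/
theorem joinFrames_equiv_update_right {α β : Fin 6 → ℝ} (hα : α.Injective) (hβ : β.Injective)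
    (m : Fin 6) (b : ℝ) (hb : ∀ j, j ≠ m → (β j - β m) * (β j - b) < 0) :
    FrameEquiv (joinFrames α β) (joinFrames α (Function.update β m b)) := by
  refine ⟨1, 1, Function.update 1 m (-1), by simp, fun i => ?_, ?_⟩
  · by_cases h : i = m <;> simp [h]
  refine joinedIn_of_affine (fun i j hij t => ?_) fun i j hij => ?_
  · by_cases hi : i = m
    · subst hi
      simp [frameDet, det2_eq, joinFrames, rescale, hij.ne']; ring
    · by_cases hj : j = m
      · subst hj
        simp [frameDet, det2_eq, joinFrames, rescale, hij.ne]; ring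
      · simp [frameDet, det2_eq, joinFrames, rescale, hi, hj]; ring
  · rw [frameDet_rescale, Equiv.Perm.coe_one, Function.comp_id, frameDet_joinFrames,
      frameDet_joinFrames]
    have ha : 0 < (α j - α i) * (α j - α i) := mul_self_pos.2 (sub_ne_zero.2 (hα.ne hij.ne'))
    by_cases hi : i = m
    · subst hi
      simp [hij.ne']
      linarith [mul_pos (neg_pos.2 (hb j hij.ne')) ha]
    · by_cases hj : j = m
      · subst hj
        simp [hij.ne]
        linarith [mul_pos (neg_pos.2 (hb i hij.ne)) ha]
      · simp [hi, hj]
        exact ⟨sub_ne_zero.2 (hα.ne hij.ne'), sub_ne_zero.2 (hβ.ne hij.ne')⟩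

/-- The frames of the join configuration `J(p)`. -/
noncomputable def permFrames (p : Fin 6 → Fin 6) : Frames :=
  joinFrames (fun i => (i.val : ℝ) + 1) fun i => ((p i).val : ℝ) + 1

theorem cast_val_injective {p : Fin 6 → Fin 6} (hp : p.Injective) (c : ℝ) :
    Function.Injective fun i => ((p i).val : ℝ) + c := by
  intro i j h
  simpa [Fin.val_inj, hp.eq_iff] using h

theorem permFrames_mem {p : Fin 6 → Fin 6} (hp : p.Injective) : permFrames p ∈ skewFrames :=
  joinFrames_mem (cast_val_injective Function.injective_id 1) (cast_val_injective hp 1)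

theorem permFrames_add_one_left {p : Fin 6 → Fin 6} (hp : p.Injective) :
    FrameEquiv (permFrames fun i => p (i + 1)) (permFrames p) := by
  have hq : Function.Injective fun i : Fin 6 => i - 1 := sub_left_injective
  have hα := cast_val_injective hq 1
  have hβ := cast_val_injective hp 1
  have hmem := permFrames_mem (p := fun i => p (i + 1)) (hp.comp (add_left_injective 1))
  refine (FrameEquiv.of_comp hmem (Equiv.addRight 1) (g := joinFrames
    (fun i => ((i - 1 : Fin 6).val : ℝ) + 1) fun i => ((p i).val : ℝ) + 1) ?_).trans ?_
  · funext i
    simp [permFrames, joinFrames]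
  refine (joinFrames_equiv_update_left hα hβ 0 0 ?_).trans (joinFrames_equiv_of_order ?_ ?_)
  · intro j hj
    fin_cases j <;> first | exact absurd rfl hj | (norm_num [Fin.val_sub])
  · intro i j hij
    fin_cases i <;> fin_cases j <;> first | exact absurd hij (by decide) |
      (norm_num [Fin.val_sub, Function.update])
  · exact fun i j hij => mul_self_pos.2 (sub_ne_zero.2 (hβ.ne hij.ne'))

theorem permFrames_add_one_right {p : Fin 6 → Fin 6} (hp : p.Bijective) :
    FrameEquiv (permFrames fun i => p i + 1) (permFrames p) := by
  obtain ⟨m, hm⟩ := hp.2 5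
  have hα := cast_val_injective (Function.injective_id (α := Fin 6)) 1
  have hβ := cast_val_injective ((add_left_injective (1 : Fin 6)).comp hp.1) 1
  have hval : ∀ j, j ≠ m → ((p j + 1 : Fin 6).val : ℝ) = (p j).val + 1 := by
    intro j hj
    have : p j ≠ 5 := fun h => hj (hp.1 (h.trans hm.symm))
    have h : ∀ x : Fin 6, x ≠ 5 → (x + 1).val = x.val + 1 := by decide
    exact_mod_cast h _ this
  refine (joinFrames_equiv_update_right hα hβ m 7 ?_).trans (joinFrames_equiv_of_order ?_ ?_)
  · intro j hj
    have h6 : ((p j).val : ℝ) < 5 := by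
      have : p j ≠ 5 := fun h => hj (hp.1 (h.trans hm.symm))
      exact_mod_cast lt_of_le_of_ne (Nat.le_of_lt_succ (p j).isLt) fun h => this (Fin.ext h)
    have h0 : (0 : ℝ) ≤ (p j).val := Nat.cast_nonneg _
    simp only [Function.comp_apply, hval j hj, hm]
    norm_num
    nlinarith
  · exact fun i j hij => mul_self_pos.2 (sub_ne_zero.2 (hα.ne hij.ne'))
  · intro i j hij
    have key : ∀ i, Function.update (fun i => (((fun i => i + 1) ∘ p) i : Fin 6).val + (1 : ℝ)) m 7 i
        = (p i).val + 2 := by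
      intro i
      by_cases hi : i = m
      · subst hi; simp [hm]; norm_num
      · simp only [Function.update_of_ne hi, Function.comp_apply, hval i hi]; ring
    have hne : ((p j).val : ℝ) ≠ (p i).val := fun h => hij.ne' (hp.1 (Fin.ext (by exact_mod_cast h)))
    rw [key i, key j]
    have := mul_self_pos.2 (sub_ne_zero.2 hne)
    linarith

theorem permFrames_rotate {p : Fin 6 → Fin 6} (hp : p.Bijective) (a b : Fin 6) :
    FrameEquiv (permFrames fun i => p (i + b) + a) (permFrames p) := by
  have add_bij : ∀ c : Fin 6, Function.Bijective fun i : Fin 6 => i + c :=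
    fun c => (Equiv.addRight c).bijective
  have hsmul : ∀ x : Fin 6, x = x.val • (1 : Fin 6) := by decide
  rw [hsmul a, hsmul b]
  generalize a.val = k
  generalize b.val = l
  induction k with
  | zero =>
    induction l with
    | zero => simpa using FrameEquiv.of_joinedIn (JoinedIn.refl (permFrames_mem hp.1))
    | succ l ih =>
      refine .trans ?_ ih
      have := permFrames_add_one_left (p := fun i => p (i + l • (1 : Fin 6)))
        (hp.1.comp (add_left_injective _))
      simpa [succ_nsmul, add_assoc, add_comm, add_left_comm] using this
  | succ k ih =>
    refine .trans ?_ ih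
    have := permFrames_add_one_right (p := fun i => p (i + l • (1 : Fin 6)) + k • (1 : Fin 6))
      ((add_bij _).comp (hp.comp (add_bij _)))
    simpa [succ_nsmul, add_assoc] using this

def tripleSum (e01 e02 e03 e04 e12 e13 e14 e23 e24 e34 : ℤ) : ℤ :=
  e01 * e12 * e02 + e01 * e13 * e03 + e01 * e14 * e04 + e02 * e23 * e03 + e02 * e24 * e04 +
  e03 * e34 * e04 + e12 * e23 * e13 + e12 * e24 * e14 + e13 * e34 * e14 + e23 * e34 * e24

theorem sum_triples {e : Fin 5 → Fin 5 → ℤ} (hs : ∀ i j, e i j = e j i) (h0 : ∀ i, e i i = 0) :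
    ∑ i, ∑ j, ∑ k, e i j * e j k * e i k =
      6 * tripleSum (e 0 1) (e 0 2) (e 0 3) (e 0 4) (e 1 2) (e 1 3) (e 1 4) (e 2 3) (e 2 4)
        (e 3 4) := by
  simp only [Fin.sum_univ_five, h0, hs 1 0, hs 2 0, hs 3 0, hs 4 0, hs 2 1, hs 3 1, hs 4 1,
    hs 3 2, hs 4 2, hs 4 3, tripleSum]
  ring

theorem bipartiteSigns_iff {e : Fin 6 → Fin 6 → ℤ} (hs : ∀ i j, e i j = e j i)
    (h0 : ∀ i, e i i = 0) : BipartiteSigns e ↔ ∀ m : Fin 6,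
      |(fun s : Fin 5 → Fin 6 => tripleSum (e (s 0) (s 1)) (e (s 0) (s 2)) (e (s 0) (s 3))
        (e (s 0) (s 4)) (e (s 1) (s 2)) (e (s 1) (s 3)) (e (s 1) (s 4)) (e (s 2) (s 3))
        (e (s 2) (s 4)) (e (s 3) (s 4))) m.succAbove| = 4 := by
  refine forall_congr' fun m => ?_
  have h : ∑ i, ∑ j, ∑ k, (if i = m ∨ j = m ∨ k = m then 0 else e i j * e j k * e i k) =
      ∑ i : Fin 5, ∑ j : Fin 5, ∑ k : Fin 5, e (m.succAbove i) (m.succAbove j) *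
        e (m.succAbove j) (m.succAbove k) * e (m.succAbove i) (m.succAbove k) := by
    rw [Fin.sum_univ_succAbove _ m]
    simp only [true_or, if_true, Finset.sum_const_zero, zero_add]
    refine Finset.sum_congr rfl fun i _ => ?_
    rw [Fin.sum_univ_succAbove _ m]
    simp only [true_or, or_true, if_true, Finset.sum_const_zero, zero_add]
    refine Finset.sum_congr rfl fun j _ => ?_
    rw [Fin.sum_univ_succAbove _ m]
    simp [Fin.succAbove_ne]
  rw [h, sum_triples (e := fun i j => e (m.succAbove i) (m.succAbove j)) (fun i j => hs _ _)
    fun i => h0 _, abs_mul]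
  norm_num
  omega

def orderSign (a b : ℕ) : ℤ := if b < a then -1 else 1

def orderTripleSum (a b c d e : ℕ) : ℤ :=
  tripleSum (orderSign a b) (orderSign a c) (orderSign a d) (orderSign a e) (orderSign b c)
    (orderSign b d) (orderSign b e) (orderSign c d) (orderSign c e) (orderSign d e)

def IsBipartiteOrder (a b c d e f : ℕ) : Prop :=
  |orderTripleSum b c d e f| = 4 ∧ |orderTripleSum a c d e f| = 4 ∧
  |orderTripleSum a b d e f| = 4 ∧ |orderTripleSum a b c e f| = 4 ∧
  |orderTripleSum a b c d f| = 4 ∧ |orderTripleSum a b c d e| = 4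

instance (a b c d e f : ℕ) : Decidable (IsBipartiteOrder a b c d e f) := by
  unfold IsBipartiteOrder; infer_instance

theorem exists_rotation_of_isBipartiteOrder : ∀ a b : Fin 6, b ≠ a → ∀ c, c ≠ a ∧ c ≠ b →
    ∀ d, d ≠ a ∧ d ≠ b ∧ d ≠ c → ∀ e, e ≠ a ∧ e ≠ b ∧ e ≠ c ∧ e ≠ d →
    ∀ f : Fin 6, f ≠ a ∧ f ≠ b ∧ f ≠ c ∧ f ≠ d ∧ f ≠ e → IsBipartiteOrder a b c d e f →
    ∃ x y : Fin 6, ∀ i, ![a, b, c, d, e, f] i = Equiv.swap (3 : Fin 6) 5 (i + y) + x := by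
  decide +kernel

/-- The bipartite condition for five lines in join position, in the order `a, b, c, d, e`,
together with a sixth line having the signs `s` with respect to them. -/
def IsBipartiteExtension (a b c d e : ℕ) (s : Fin 5 → ℤ) : Prop :=
  |orderTripleSum a b c d e| = 4 ∧
  |tripleSum (s 1) (s 2) (s 3) (s 4) (orderSign b c) (orderSign b d) (orderSign b e)
    (orderSign c d) (orderSign c e) (orderSign d e)| = 4 ∧
  |tripleSum (s 0) (s 2) (s 3) (s 4) (orderSign a c) (orderSign a d) (orderSign a e)
    (orderSign c d) (orderSign c e) (orderSign d e)| = 4 ∧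
  |tripleSum (s 0) (s 1) (s 3) (s 4) (orderSign a b) (orderSign a d) (orderSign a e)
    (orderSign b d) (orderSign b e) (orderSign d e)| = 4 ∧
  |tripleSum (s 0) (s 1) (s 2) (s 4) (orderSign a b) (orderSign a c) (orderSign a e)
    (orderSign b c) (orderSign b e) (orderSign c e)| = 4 ∧
  |tripleSum (s 0) (s 1) (s 2) (s 3) (orderSign a b) (orderSign a c) (orderSign a d)
    (orderSign b c) (orderSign b d) (orderSign c d)| = 4

instance (a b c d e : ℕ) (s : Fin 5 → ℤ) : Decidable (IsBipartiteExtension a b c d e s) := by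
  unfold IsBipartiteExtension; infer_instance

set_option synthInstance.maxHeartbeats 200000 in
set_option synthInstance.maxSize 1000 in
theorem extreme_of_isBipartiteExtension : ∀ a b : Fin 5, b ≠ a → ∀ c, c ≠ a ∧ c ≠ b →
    ∀ d, d ≠ a ∧ d ≠ b ∧ d ≠ c → ∀ e, e ≠ a ∧ e ≠ b ∧ e ≠ c ∧ e ≠ d → ∀ k : Fin 5,
    IsBipartiteExtension a b c d e (fun j => if j = k then -1 else 1) →
    k = 0 ∨ k = 4 ∨ ![a, b, c, d, e] k = 0 ∨ ![a, b, c, d, e] k = 4 := by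
  decide +kernel

/-- The permutation ranking the values of a function. -/
noncomputable def rank {n : ℕ} (g : Fin n → ℝ) : Equiv.Perm (Fin n) := (Tuple.sort g)⁻¹

theorem strictMono_comp_rank_symm {n : ℕ} {g : Fin n → ℝ} (hg : g.Injective) :
    StrictMono (g ∘ (rank g).symm) :=
  (Tuple.monotone_sort g).strictMono_of_injective (hg.comp (Tuple.sort g).injective)

theorem rank_lt_rank {n : ℕ} {g : Fin n → ℝ} (hg : g.Injective) {i j : Fin n} :
    rank g i < rank g j ↔ g i < g j := by
  rw [← (strictMono_comp_rank_symm hg).lt_iff_lt]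
  simp

theorem rank_sub_pos {n : ℕ} {g : Fin n → ℝ} (hg : g.Injective) {i j : Fin n} (hij : i ≠ j)
    (c : ℝ) : 0 < (g j - g i) * (((rank g j).val + c) - ((rank g i).val + c) : ℝ) := by
  rcases lt_or_gt_of_ne (hg.ne hij) with h | h
  · have h' : ((rank g i).val : ℝ) < (rank g j).val := by exact_mod_cast (rank_lt_rank hg).2 h
    nlinarith
  · have h' : ((rank g j).val : ℝ) < (rank g i).val := by exact_mod_cast (rank_lt_rank hg).2 h
    nlinarith

theorem frameSign_permFrames {p : Fin 6 → Fin 6} (hp : p.Injective) {i j : Fin 6} (hij : i < j) :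
    frameSign (permFrames p) i j = orderSign (p i) (p j) := by
  have h1 : (0 : ℝ) < (j.val + 1 : ℝ) - (i.val + 1) := by
    have : (i.val : ℝ) < j.val := by exact_mod_cast hij
    linarith
  rw [frameSign, permFrames, frameDet_joinFrames, _root_.sign_mul, sign_pos h1, one_mul, orderSign]
  rcases lt_or_gt_of_ne (hp.ne hij.ne) with h | h
  · have h' : ((p i).val : ℝ) < (p j).val := by exact_mod_cast h
    rw [sign_pos (by linarith), if_neg (by simpa using h.le)]
    rfl
  · have h' : ((p j).val : ℝ) < (p i).val := by exact_mod_cast h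
    rw [sign_neg (by linarith), if_pos (by simpa using h)]
    rfl

theorem frameSign_symm (f : Frames) (i j : Fin 6) : frameSign f i j = frameSign f j i := by
  rw [frameSign, frameDet_symm, frameSign]

theorem frameSign_self (f : Frames) (i : Fin 6) : frameSign f i i = 0 := by
  simp [frameSign, frameDet_self]

theorem permFrames_equiv_of_bipartiteSigns {p : Fin 6 → Fin 6} (hp : p.Bijective)
    (hb : BipartiteSigns (frameSign (permFrames p))) :
    FrameEquiv (permFrames p) (permFrames (Equiv.swap 3 5)) := by
  rw [bipartiteSigns_iff (frameSign_symm _) (frameSign_self _)] at hb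
  have hne : ∀ {i j}, i ≠ j → p i ≠ p j := fun h => hp.1.ne h
  have hord : IsBipartiteOrder (p 0) (p 1) (p 2) (p 3) (p 4) (p 5) := by
    have e : ∀ {i j : Fin 6}, i < j → orderSign (p i) (p j) = frameSign (permFrames p) i j :=
      fun h => (frameSign_permFrames hp.1 h).symm
    unfold IsBipartiteOrder orderTripleSum
    rw [e (show (0 : Fin 6) < 1 by decide), e (show (0 : Fin 6) < 2 by decide),
      e (show (0 : Fin 6) < 3 by decide), e (show (0 : Fin 6) < 4 by decide),
      e (show (0 : Fin 6) < 5 by decide), e (show (1 : Fin 6) < 2 by decide),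
      e (show (1 : Fin 6) < 3 by decide), e (show (1 : Fin 6) < 4 by decide),
      e (show (1 : Fin 6) < 5 by decide), e (show (2 : Fin 6) < 3 by decide),
      e (show (2 : Fin 6) < 4 by decide), e (show (2 : Fin 6) < 5 by decide),
      e (show (3 : Fin 6) < 4 by decide), e (show (3 : Fin 6) < 5 by decide),
      e (show (4 : Fin 6) < 5 by decide)]
    exact ⟨hb 0, hb 1, hb 2, hb 3, hb 4, hb 5⟩
  obtain ⟨x, y, hxy⟩ := exists_rotation_of_isBipartiteOrder (p 0) (p 1) (hne (by decide)) (p 2)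
    ⟨hne (by decide), hne (by decide)⟩ (p 3) ⟨hne (by decide), hne (by decide), hne (by decide)⟩
    (p 4) ⟨hne (by decide), hne (by decide), hne (by decide), hne (by decide)⟩ (p 5)
    ⟨hne (by decide), hne (by decide), hne (by decide), hne (by decide), hne (by decide)⟩ hord
  have hp' : p = fun i => Equiv.swap (3 : Fin 6) 5 (i + y) + x := by
    funext i
    rw [← hxy i]
    fin_cases i <;> rfl
  rw [hp']
  exact permFrames_rotate (Equiv.swap (3 : Fin 6) 5).bijective x y

theorem joinFrames_equiv_of_bipartiteSigns {α β : Fin 6 → ℝ}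
    (hmem : joinFrames α β ∈ skewFrames) (hb : BipartiteSigns (frameSign (joinFrames α β))) :
    FrameEquiv (joinFrames α β) (permFrames (Equiv.swap 3 5)) := by
  obtain ⟨hα, hβ⟩ := injective_of_joinFrames_mem hmem
  set σ := (rank α).symm
  have hα' : StrictMono (α ∘ σ) := strictMono_comp_rank_symm hα
  have hβ' : (β ∘ σ).Injective := hβ.comp σ.injective
  have key : FrameEquiv (joinFrames α β) (permFrames (rank (β ∘ σ))) := by
    refine (FrameEquiv.of_comp hmem (rank α) (g := joinFrames (α ∘ σ) (β ∘ σ)) ?_).trans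
      (joinFrames_equiv_of_order (fun i j hij => ?_) fun i j hij => ?_)
    · funext i
      simp [joinFrames, σ]
    · have h1 := hα' hij
      have h2 : (i.val : ℝ) < j.val := by exact_mod_cast hij
      exact mul_pos (by linarith) (by linarith)
    · exact rank_sub_pos hβ' hij.ne 1
  exact key.trans (permFrames_equiv_of_bipartiteSigns (rank (β ∘ σ)).bijective
    (key.bipartiteSigns hb))

/-- Five lines close to join position (exactly in join position for `t = 0`) with a line
prepended. -/
noncomputable def consFrames (x y r s z w : ℝ) (α β : Fin 5 → ℝ) (t : ℝ) : Frames :=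
  Fin.cons (![x, y, 0, 0], ![s, r, z, w])
    fun j => (![1, α j, if j = 4 then t else 0, 0], ![0, 0, β j, 1])

noncomputable def consDet (x y r s z w : ℝ) (α β : Fin 5 → ℝ) (t : ℝ) (j : Fin 5) : ℝ :=
  (y - x * α j) * (z - β j * w) + (if j = 4 then t else 0) * (x * r - y * s)

theorem frameDet_consFrames_zero (x y r s z w : ℝ) (α β : Fin 5 → ℝ) (t : ℝ) (j : Fin 5) :
    frameDet (consFrames x y r s z w α β t) 0 j.succ = consDet x y r s z w α β t j := by
  simp [frameDet, det2_eq, consFrames, consDet]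
  split_ifs <;> ring

theorem frameDet_consFrames_succ (x y r s z w : ℝ) (α β : Fin 5 → ℝ) (t : ℝ) (i j : Fin 5) :
    frameDet (consFrames x y r s z w α β t) i.succ j.succ = (α j - α i) * (β j - β i) := by
  simp [frameDet, det2_eq, consFrames]; ring

theorem injective_of_consFrames_mem {x y r s z w : ℝ} {α β : Fin 5 → ℝ} {t : ℝ}
    (h : consFrames x y r s z w α β t ∈ skewFrames) : α.Injective ∧ β.Injective := by
  constructor <;> intro i j hij <;> by_contra hne <;>
    apply h i.succ j.succ ((Fin.succ_injective _).ne hne) <;>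
    simp [frameDet_consFrames_succ, hij]

theorem consFrames_joinedIn {x y r s z w x' y' r' s' z' w' : ℝ} {α β : Fin 5 → ℝ} {t t' : ℝ}
    (hα : α.Injective) (hβ : β.Injective)
    (haff : ∀ j (τ : ℝ), consDet ((1 - τ) * x + τ * x') ((1 - τ) * y + τ * y')
      ((1 - τ) * r + τ * r') ((1 - τ) * s + τ * s') ((1 - τ) * z + τ * z')
      ((1 - τ) * w + τ * w') α β ((1 - τ) * t + τ * t') j =
      (1 - τ) * consDet x y r s z w α β t j + τ * consDet x' y' r' s' z' w' α β t' j)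
    (hpos : ∀ j, 0 < consDet x y r s z w α β t j * consDet x' y' r' s' z' w' α β t' j) :
    JoinedIn skewFrames (consFrames x y r s z w α β t) (consFrames x' y' r' s' z' w' α β t') := by
  refine joinedIn_of_affine (fun i j hij τ => ?_) fun i j hij => ?_
  · have h : (fun i => (1 - τ) • consFrames x y r s z w α β t i +
        τ • consFrames x' y' r' s' z' w' α β t' i) =
        consFrames ((1 - τ) * x + τ * x') ((1 - τ) * y + τ * y')
          ((1 - τ) * r + τ * r') ((1 - τ) * s + τ * s') ((1 - τ) * z + τ * z')
          ((1 - τ) * w + τ * w') α β ((1 - τ) * t + τ * t') := by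
      funext i
      refine Fin.cases ?_ (fun j => ?_) i
      · simp [consFrames]
      · simp only [consFrames, Fin.cons_succ, Prod.smul_mk, Prod.mk_add_mk, Matrix.smul_cons,
          Matrix.smul_empty, Matrix.add_cons, Matrix.head_cons, Matrix.tail_cons,
          Matrix.empty_add_empty, smul_eq_mul]
        split_ifs <;> ring_nf
    rw [h]
    revert hij
    refine Fin.cases ?_ (fun i => ?_) i <;> refine Fin.cases ?_ (fun j => ?_) j <;> intro hij
    · simp at hij
    · simp only [frameDet_consFrames_zero, haff]
    · simp at hij
    · simp only [frameDet_consFrames_succ]; ring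
  · revert hij
    refine Fin.cases ?_ (fun i => ?_) i <;> refine Fin.cases ?_ (fun j => ?_) j <;> intro hij
    · simp at hij
    · simpa only [frameDet_consFrames_zero] using hpos j
    · simp at hij
    · simp only [frameDet_consFrames_succ]
      have hij : i ≠ j := fun h => hij.ne (congrArg _ h)
      exact mul_self_pos.2 (mul_ne_zero (sub_ne_zero.2 (hα.ne hij.symm))
        (sub_ne_zero.2 (hβ.ne hij.symm)))

theorem eventually_add_ne_zero (a : ℝ) : ∀ᶠ ε in nhdsWithin (0 : ℝ) {0}ᶜ, a + ε ≠ 0 := by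
  by_cases ha : a = 0
  · filter_upwards [self_mem_nhdsWithin] with ε hε
    simpa [ha] using hε
  · have : ContinuousAt (fun ε : ℝ => a + ε) 0 := by fun_prop
    exact (this.eventually_ne (by simpa using ha)).filter_mono nhdsWithin_le_nhds

theorem consFrames_equiv_joinFrames {x y z w : ℝ} {α β : Fin 5 → ℝ}
    (h : consFrames x y 0 0 z w α β 0 ∈ skewFrames) :
    ∃ α' β', FrameEquiv (consFrames x y 0 0 z w α β 0) (joinFrames α' β') := by
  have hc : Filter.Tendsto (fun ε => consFrames (x + ε) y 0 0 z (w + ε) α β 0)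
      (nhdsWithin 0 {0}ᶜ) (nhds (consFrames x y 0 0 z w α β 0)) := by
    have : Continuous fun ε => consFrames (x + ε) y 0 0 z (w + ε) α β 0 := by
      refine continuous_pi fun i => ?_
      refine Fin.cases ?_ (fun j => ?_) i
      · simp only [consFrames, Fin.cons_zero]
        fun_prop
      · simp only [consFrames, Fin.cons_succ]
        fun_prop
    have h0 := this.tendsto 0
    simp only [add_zero] at h0
    exact h0.mono_left nhdsWithin_le_nhds
  obtain ⟨ε, hj, hx, hw⟩ :=
    ((hc.eventually (eventually_joinedIn_skewFrames h)).and
      ((eventually_add_ne_zero x).and (eventually_add_ne_zero w))).exists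
  refine ⟨Fin.cons (y / (x + ε)) α, Fin.cons (z / (w + ε)) β, (FrameEquiv.of_joinedIn hj).trans
    (.of_rescale_comp hj.target_mem (c := Fin.cons (x + ε) 1) (d := Fin.cons (w + ε) 1)
      ?_ ?_ 1 ?_)⟩
  · exact fun i => Fin.cases hx (fun j => by simp) i
  · exact fun i => Fin.cases hw (fun j => by simp) i
  · funext i
    refine Fin.cases ?_ (fun j => ?_) i
    · simp [rescale, joinFrames, consFrames, mul_div_cancel₀ _ hx, mul_div_cancel₀ _ hw]
    · simp [rescale, joinFrames, consFrames]

def IsEndValue (g : Fin 5 → ℝ) (k : Fin 5) : Prop := ∃ c, ∀ j, j ≠ k → (c - g j) * (c - g k) < 0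

theorem IsEndValue.of_forall_lt {g : Fin 5 → ℝ} {k : Fin 5} (h : ∀ j, j ≠ k → g k < g j) :
    IsEndValue g k := by
  obtain ⟨c, h1, h2⟩ := Finset.exists_between' {g k} ((Finset.univ.erase k).image g)
    (by simpa using h)
  refine ⟨c, fun j hj => ?_⟩
  have h1 := h1 (g k) (by simp)
  have h2 := h2 (g j) (Finset.mem_image_of_mem _ (by simpa using hj))
  nlinarith

theorem IsEndValue.of_forall_gt {g : Fin 5 → ℝ} {k : Fin 5} (h : ∀ j, j ≠ k → g j < g k) :
    IsEndValue g k := by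
  obtain ⟨c, h1, h2⟩ := Finset.exists_between' ((Finset.univ.erase k).image g) {g k}
    (by simpa using h)
  refine ⟨c, fun j hj => ?_⟩
  have h1 := h1 (g j) (Finset.mem_image_of_mem _ (by simpa using hj))
  have h2 := h2 (g k) (by simp)
  nlinarith

theorem IsEndValue.of_rank {g : Fin 5 → ℝ} (hg : g.Injective) {k : Fin 5}
    (h : rank g k = 0 ∨ rank g k = 4) : IsEndValue g k := by
  rcases h with h | h
  · refine .of_forall_lt fun j hj => (rank_lt_rank hg).1 ?_
    rw [h]
    exact Fin.pos_iff_ne_zero.2 fun h' => hj ((rank g).injective (h'.trans h.symm))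
  · refine .of_forall_gt fun j hj => (rank_lt_rank hg).1 ?_
    rw [h]
    exact lt_of_le_of_ne (Fin.le_last _) fun h' => hj ((rank g).injective (h'.trans h.symm))

theorem sign_eq_orderSign {g : Fin 5 → ℝ} (hg : g.Injective) {i j : Fin 5} (hij : i ≠ j) :
    (SignType.sign (g j - g i) : ℤ) = orderSign (rank g i) (rank g j) := by
  rw [orderSign]
  rcases lt_or_gt_of_ne (hg.ne hij) with h | h
  · have h' := (rank_lt_rank hg).2 h
    rw [sign_pos (by linarith), if_neg (by simpa using h'.le)]
    rfl
  · have h' := (rank_lt_rank hg).2 h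
    rw [sign_neg (by linarith), if_pos (by simpa using h')]
    rfl

theorem isEndValue_of_bipartiteSigns {α β : Fin 5 → ℝ} (hα : α.Injective) (hβ : β.Injective)
    (k : Fin 5) {e : Fin 6 → Fin 6 → ℤ} (hs : ∀ i j, e i j = e j i) (h0 : ∀ i, e i i = 0)
    (he0 : ∀ j : Fin 5, e 0 j.succ = if j = k then -1 else 1)
    (he : ∀ i j : Fin 5, e i.succ j.succ = SignType.sign ((α j - α i) * (β j - β i)))
    (hb : BipartiteSigns e) : IsEndValue α k ∨ IsEndValue β k := by
  set σ := (rank α).symm with hσ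
  have hα' : StrictMono (α ∘ σ) := strictMono_comp_rank_symm hα
  have hβ' : (β ∘ σ).Injective := hβ.comp σ.injective
  set q := rank (β ∘ σ) with hq
  have hb' := hb.comp (Equiv.Perm.decomposeFin.symm (0, σ))
  rw [bipartiteSigns_iff (fun i j => hs _ _) fun i => h0 _] at hb'
  have hS : ∀ j : Fin 5, (Equiv.Perm.decomposeFin.symm (0, σ)) j.succ = (σ j).succ := by
    intro j; simp
  have hS0 : (Equiv.Perm.decomposeFin.symm ((0 : Fin 6), σ)) 0 = 0 := by simp
  set E : Fin 6 → Fin 6 → ℤ := fun i j => e (Equiv.Perm.decomposeFin.symm (0, σ) i)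
    (Equiv.Perm.decomposeFin.symm (0, σ) j) with hE
  have hE0 : ∀ j : Fin 5, (fun j => if j = rank α k then (-1 : ℤ) else 1) j = E 0 j.succ := by
    intro j
    simp only [hE, hS, hS0, he0]
    simp only [hσ, Equiv.symm_apply_eq]
  have hE1 : ∀ {i j : Fin 5}, i < j → orderSign (q i) (q j) = E i.succ j.succ := by
    intro i j hij
    rw [← sign_eq_orderSign hβ' hij.ne]
    simp only [hE, hS, he, _root_.sign_mul, SignType.coe_mul]
    have : SignType.sign (α (σ j) - α (σ i)) = 1 := sign_pos (sub_pos.2 (hα' hij))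
    simp [this]
  have hne : ∀ {i j}, i ≠ j → q i ≠ q j := fun h => q.injective.ne h
  have hext : IsBipartiteExtension (q 0) (q 1) (q 2) (q 3) (q 4)
      (fun j => if j = rank α k then (-1 : ℤ) else 1) := by
    unfold IsBipartiteExtension orderTripleSum
    rw [hE0, hE0, hE0, hE0, hE0, hE1 (show (0 : Fin 5) < 1 by decide),
      hE1 (show (0 : Fin 5) < 2 by decide), hE1 (show (0 : Fin 5) < 3 by decide),
      hE1 (show (0 : Fin 5) < 4 by decide), hE1 (show (1 : Fin 5) < 2 by decide),
      hE1 (show (1 : Fin 5) < 3 by decide), hE1 (show (1 : Fin 5) < 4 by decide),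
      hE1 (show (2 : Fin 5) < 3 by decide), hE1 (show (2 : Fin 5) < 4 by decide),
      hE1 (show (3 : Fin 5) < 4 by decide)]
    exact ⟨hb' 0, hb' 1, hb' 2, hb' 3, hb' 4, hb' 5⟩
  have hx := extreme_of_isBipartiteExtension (q 0) (q 1) (hne (by decide)) (q 2)
    ⟨hne (by decide), hne (by decide)⟩ (q 3) ⟨hne (by decide), hne (by decide), hne (by decide)⟩
    (q 4) ⟨hne (by decide), hne (by decide), hne (by decide), hne (by decide)⟩ (rank α k) hext
  have hv : ∀ i, ![q 0, q 1, q 2, q 3, q 4] i = q i := by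
    intro i; fin_cases i <;> rfl
  rw [hv] at hx
  have hβσ : IsEndValue (β ∘ σ) (rank α k) → IsEndValue β k := by
    rintro ⟨c, hc⟩
    refine ⟨c, fun j hj => ?_⟩
    simpa [hσ] using hc (rank α j) ((rank α).injective.ne hj)
  rcases hx with h | h | h | h
  · exact .inl (.of_rank hα (.inl h))
  · exact .inl (.of_rank hα (.inr h))
  · exact .inr (hβσ (.of_rank hβ' (.inl h)))
  · exact .inr (hβσ (.of_rank hβ' (.inr h)))

theorem consFrames_zero_one_equiv {s t : ℝ} {α β : Fin 5 → ℝ}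
    (h : consFrames 0 1 0 s 1 0 α β t ∈ skewFrames)
    (hb : BipartiteSigns (frameSign (consFrames 0 1 0 s 1 0 α β t))) :
    ∃ α' β', FrameEquiv (consFrames 0 1 0 s 1 0 α β t) (joinFrames α' β') := by
  obtain ⟨hα, hβ⟩ := injective_of_consFrames_mem h
  have finish : ∀ x y r s z w, JoinedIn skewFrames (consFrames 0 1 0 s 1 0 α β t)
      (consFrames x y r s z w α β t) → (∀ j, 0 < consDet x y r s z w α β t j *
        consDet x y 0 0 z w α β t j) →
      ∃ α' β', FrameEquiv (consFrames 0 1 0 s 1 0 α β t) (joinFrames α' β') := by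
    intro x y r s' z w hj hpos
    have hne : ∀ j, consDet x y 0 0 z w α β t j ≠ 0 := fun j => right_ne_zero_of_mul (hpos j).ne'
    have h1 : JoinedIn skewFrames (consFrames x y r s' z w α β t) (consFrames x y 0 0 z w α β t) :=
      consFrames_joinedIn hα hβ (fun j τ => by simp only [consDet]; split_ifs <;> ring) hpos
    have h2 : JoinedIn skewFrames (consFrames x y 0 0 z w α β t) (consFrames x y 0 0 z w α β 0) := by
      refine consFrames_joinedIn hα hβ (fun j τ => by simp only [consDet]; split_ifs <;> ring) fun j => ?_
      have : consDet x y 0 0 z w α β 0 j = consDet x y 0 0 z w α β t j := by simp [consDet]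
      rw [this]
      exact mul_self_pos.2 (hne j)
    obtain ⟨α', β', h'⟩ := consFrames_equiv_joinFrames h2.target_mem
    exact ⟨α', β', (FrameEquiv.of_joinedIn (hj.trans (h1.trans h2))).trans h'⟩
  have hd : ∀ j, consDet 0 1 0 s 1 0 α β t j = 1 - if j = 4 then s * t else 0 := by
    intro j; simp only [consDet]; split_ifs <;> ring
  have hst : 1 - s * t ≠ 0 := by
    have := h 0 (Fin.succ 4) (by decide)
    rwa [frameDet_consFrames_zero, hd, if_pos rfl] at this
  rcases lt_or_gt_of_ne hst with hlt | hgt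
  · have hext : IsEndValue α 4 ∨ IsEndValue β 4 := by
      refine isEndValue_of_bipartiteSigns hα hβ 4 (frameSign_symm _) (frameSign_self _)
        (fun j => ?_) (fun i j => ?_) hb
      · rw [frameSign, frameDet_consFrames_zero, hd]
        split_ifs
        · simp [hlt]
        · simp
      · rw [frameSign, frameDet_consFrames_succ]
    rcases hext with ⟨c, hc⟩ | ⟨c, hc⟩
    · have hc4 : α 4 - c ≠ 0 := fun h0 => by
        have := hc 0 (by decide)
        rw [show c - α 4 = 0 by linarith, mul_zero] at this
        exact this.ne rfl
      have hsq := mul_self_pos.2 hc4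
      obtain ⟨r, hr⟩ : ∃ r, (α 4 - c) * r = ((α 4 - c) * c - 1) * s :=
        ⟨_, mul_div_cancel₀ _ hc4⟩
      have h1 : JoinedIn skewFrames (consFrames 0 1 0 s 1 0 α β t)
          (consFrames 0 1 r s 1 0 α β t) := by
        refine consFrames_joinedIn hα hβ (fun j τ => by simp only [consDet]; split_ifs <;> ring) fun j => ?_
        have : consDet 0 1 r s 1 0 α β t j = consDet 0 1 0 s 1 0 α β t j := by simp [consDet]
        rw [this, hd]
        split_ifs
        · exact mul_self_pos.2 hst
        · norm_num
      refine finish (α 4 - c) ((α 4 - c) * c) r s 1 0 (h1.trans (consFrames_joinedIn hα hβ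
        (fun j τ => by simp only [consDet]; split_ifs <;> ring) fun j => ?_)) fun j => ?_
      · by_cases hj : j = 4
        · subst hj
          simp only [consDet, if_pos]
          have : 0 < (1 - s * t) * (-((α 4 - c) * (α 4 - c)) - s * t) :=
            mul_pos_of_neg_of_neg hlt (by linarith)
          linear_combination this - (1 - s * t) * t * hr
        · simp only [consDet, if_neg hj]
          linarith [hc j hj]
      · by_cases hj : j = 4
        · subst hj
          simp only [consDet, if_pos]
          have : 0 < (-((α 4 - c) * (α 4 - c)) - s * t) * -((α 4 - c) * (α 4 - c)) :=
            mul_pos_of_neg_of_neg (by linarith) (by linarith)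
          linear_combination this + ((α 4 - c) * (α 4 - c)) * t * hr
        · simp only [consDet, if_neg hj]
          nlinarith [mul_pos_of_neg_of_neg (hc j hj) (hc j hj)]
    · have hc4 : β 4 - c ≠ 0 := fun h0 => by
        have := hc 0 (by decide)
        rw [show c - β 4 = 0 by linarith, mul_zero] at this
        exact this.ne rfl
      have hsq := mul_self_pos.2 hc4
      refine finish 0 1 0 s ((β 4 - c) * c) (β 4 - c) (consFrames_joinedIn hα hβ
        (fun j τ => by simp only [consDet]; split_ifs <;> ring) fun j => ?_) fun j => ?_
      · by_cases hj : j = 4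
        · subst hj
          simp only [consDet, if_pos]
          nlinarith
        · simp only [consDet, if_neg hj]
          linarith [hc j hj]
      · by_cases hj : j = 4
        · subst hj
          simp only [consDet, if_pos]
          nlinarith
        · simp only [consDet, if_neg hj]
          nlinarith [mul_pos_of_neg_of_neg (hc j hj) (hc j hj)]
  · refine finish 0 1 0 s 1 0 (JoinedIn.refl h) fun j => ?_
    rw [hd]
    simp only [consDet]
    split_ifs <;> linarith

/-- Lines meeting one or both of two fixed skew coordinate lines: the first line meets only the
first coordinate line, the last one only the second coordinate line. -/
noncomputable def transversalFrames (y₀ s z₀ : ℝ) (x y z w : Fin 5 → ℝ) (t t' : ℝ) : Frames :=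
  Fin.cons (![0, y₀, 0, 0], ![s, 0, z₀, 0])
    fun j => (![x j, y j, if j = 4 then t else 0, if j = 4 then t' else 0], ![0, 0, z j, w j])

theorem frameDet_transversalFrames_zero (y₀ s z₀ : ℝ) (x y z w : Fin 5 → ℝ) (t t' : ℝ)
    (j : Fin 5) : frameDet (transversalFrames y₀ s z₀ x y z w t t') 0 j.succ =
      y₀ * (z₀ * (x j * w j) - if j = 4 then s * (t * w j - t' * z j) else 0) := by
  simp [frameDet, det2_eq, transversalFrames]
  split_ifs <;> ring

theorem frameDet_transversalFrames_succ (y₀ s z₀ : ℝ) (x y z w : Fin 5 → ℝ) (t t' : ℝ)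
    (i j : Fin 5) : frameDet (transversalFrames y₀ s z₀ x y z w t t') i.succ j.succ =
      (x i * y j - y i * x j) * (w i * z j - z i * w j) := by
  simp [frameDet, det2_eq, transversalFrames]
  ring

theorem transversalFrames_equiv_of_ne_zero {y₀ s z₀ : ℝ} {x y z w : Fin 5 → ℝ} {t t' : ℝ}
    (h : transversalFrames y₀ s z₀ x y z w t t' ∈ skewFrames)
    (hb : BipartiteSigns (frameSign (transversalFrames y₀ s z₀ x y z w t t')))
    (hy : y₀ ≠ 0) (hz : z₀ ≠ 0) (hx : ∀ j, x j ≠ 0) (hw : ∀ j, w j ≠ 0) :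
    FrameEquiv (transversalFrames y₀ s z₀ x y z w t t') (permFrames (Equiv.swap 3 5)) := by
  obtain ⟨r, hr⟩ : ∃ r, r * w 4 = t * w 4 - t' * z 4 := ⟨_, div_mul_cancel₀ _ (hw 4)⟩
  have h1 : JoinedIn skewFrames (transversalFrames y₀ s z₀ x y z w t t')
      (transversalFrames y₀ s z₀ x y z w r 0) := by
    have key : ∀ i j, i < j → ∀ τ : ℝ, frameDet (fun i =>
        (1 - τ) • transversalFrames y₀ s z₀ x y z w t t' i +
          τ • transversalFrames y₀ s z₀ x y z w r 0 i) i j =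
        frameDet (transversalFrames y₀ s z₀ x y z w t t') i j := by
      intro i j hij τ
      have hcomb : (fun i => (1 - τ) • transversalFrames y₀ s z₀ x y z w t t' i +
          τ • transversalFrames y₀ s z₀ x y z w r 0 i) =
          transversalFrames y₀ s z₀ x y z w ((1 - τ) * t + τ * r) ((1 - τ) * t') := by
        funext i
        refine Fin.cases ?_ (fun j => ?_) i
        · simp only [transversalFrames, Fin.cons_zero]; module
        · simp only [transversalFrames, Fin.cons_succ, Prod.smul_mk, Prod.mk_add_mk,
            Matrix.smul_cons, Matrix.smul_empty, Matrix.add_cons, Matrix.head_cons,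
            Matrix.tail_cons, Matrix.empty_add_empty, smul_eq_mul]
          split_ifs <;> ring_nf
      rw [hcomb]
      revert hij
      refine Fin.cases ?_ (fun i => ?_) i <;> refine Fin.cases ?_ (fun j => ?_) j <;> intro hij
      · simp at hij
      · simp only [frameDet_transversalFrames_zero]
        split_ifs with hj
        · subst hj; linear_combination -y₀ * s * τ * hr
        · rfl
      · simp at hij
      · simp only [frameDet_transversalFrames_succ]
    have key1 : ∀ i j, i < j → frameDet (transversalFrames y₀ s z₀ x y z w r 0) i j =
        frameDet (transversalFrames y₀ s z₀ x y z w t t') i j := by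
      intro i j hij
      simpa using key i j hij 1
    refine joinedIn_of_affine (fun i j hij τ => ?_) fun i j hij => ?_
    · rw [key i j hij, key1 i j hij]; ring
    · rw [key1 i j hij]; exact mul_self_pos.2 (h i j hij.ne)
  have h2 : FrameEquiv (transversalFrames y₀ s z₀ x y z w t t')
      (consFrames 0 1 0 (s / z₀) 1 0 (fun j => y j / x j) (fun j => z j / w j) (r / x 4)) := by
    refine (FrameEquiv.of_joinedIn h1).trans (.of_rescale_comp h1.target_mem
      (c := Fin.cons y₀ x) (d := Fin.cons z₀ w) (fun i => Fin.cases hy hx i)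
      (fun i => Fin.cases hz hw i) 1 ?_)
    funext i
    refine Fin.cases ?_ (fun j => ?_) i
    · simp [rescale, transversalFrames, consFrames, mul_div_cancel₀ _ hz]
    · simp only [rescale, transversalFrames, consFrames, Fin.cons_succ, Function.comp_apply,
        Equiv.Perm.coe_one, id]
      by_cases hj : j = 4
      · subst hj
        simp [mul_div_cancel₀ _ (hx _), mul_div_cancel₀ _ (hw _)]
      · simp [mul_div_cancel₀ _ (hx _), mul_div_cancel₀ _ (hw _), hj]
  obtain ⟨α, β, h3⟩ := consFrames_zero_one_equiv h2.right_mem (h2.bipartiteSigns hb)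
  have h4 := h2.trans h3
  exact h4.trans (joinFrames_equiv_of_bipartiteSigns h4.right_mem (h4.bipartiteSigns hb))

theorem transversalFrames_equiv {y₀ s z₀ : ℝ} {x y z w : Fin 5 → ℝ} {t t' : ℝ}
    (h : transversalFrames y₀ s z₀ x y z w t t' ∈ skewFrames)
    (hb : BipartiteSigns (frameSign (transversalFrames y₀ s z₀ x y z w t t'))) :
    FrameEquiv (transversalFrames y₀ s z₀ x y z w t t') (permFrames (Equiv.swap 3 5)) := by
  have hne : ∀ j, j ≠ 4 → y₀ * (z₀ * (x j * w j)) ≠ 0 := by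
    intro j hj
    have := h 0 j.succ (Fin.succ_ne_zero j).symm
    rwa [frameDet_transversalFrames_zero, if_neg hj, sub_zero] at this
  set F : ℝ → Frames := fun ε => transversalFrames y₀ s z₀ (fun j => x j + if j = 4 then ε else 0)
    y z (fun j => w j + if j = 4 then ε else 0) t t' with hF
  have hF0 : F 0 = transversalFrames y₀ s z₀ x y z w t t' := by simp [hF]
  have hc : Filter.Tendsto F (nhdsWithin 0 {0}ᶜ) (nhds (F 0)) := by
    have : Continuous F := by
      refine continuous_pi fun i => ?_
      refine Fin.cases ?_ (fun j => ?_) i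
      · simp only [hF, transversalFrames, Fin.cons_zero]
        fun_prop
      · by_cases hj : j = 4
        · simp only [hF, transversalFrames, Fin.cons_succ, hj, if_true]
          fun_prop
        · simp only [hF, transversalFrames, Fin.cons_succ, hj, if_false]
          fun_prop
    exact (this.tendsto 0).mono_left nhdsWithin_le_nhds
  rw [hF0] at hc
  obtain ⟨ε, hj, hx, hw⟩ := ((hc.eventually (eventually_joinedIn_skewFrames h)).and
    ((eventually_add_ne_zero (x 4)).and (eventually_add_ne_zero (w 4)))).exists
  have h1 := FrameEquiv.of_joinedIn hj
  have h0 := hne 0 (by decide)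
  refine h1.trans (transversalFrames_equiv_of_ne_zero hj.target_mem (h1.bipartiteSigns hb)
    (left_ne_zero_of_mul h0) (left_ne_zero_of_mul (right_ne_zero_of_mul h0)) ?_ ?_)
  · intro j
    by_cases hj : j = 4
    · simpa [hj] using hx
    · simpa [hj] using left_ne_zero_of_mul (right_ne_zero_of_mul (right_ne_zero_of_mul (hne j hj)))
  · intro j
    by_cases hj : j = 4
    · simpa [hj] using hw
    · simpa [hj] using right_ne_zero_of_mul (right_ne_zero_of_mul (right_ne_zero_of_mul (hne j hj)))

noncomputable def actFrames (M : Matrix (Fin 4) (Fin 4) ℝ) (f : Frames) : Frames :=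
  fun i => (M.mulVec (f i).1, M.mulVec (f i).2)

theorem det2_mulVec (M : Matrix (Fin 4) (Fin 4) ℝ) (a b c d : V4) :
    det2 (M.mulVec a) (M.mulVec b) (M.mulVec c) (M.mulVec d) = M.det * det2 a b c d := by
  rw [det2, det2, ← Matrix.det_transpose M, mul_comm, ← Matrix.det_mul]
  congr 1
  ext i j
  fin_cases i <;> simp [Matrix.mul_apply, Matrix.mulVec, dotProduct, mul_comm]

theorem frameDet_actFrames (M : Matrix (Fin 4) (Fin 4) ℝ) (f : Frames) (i j : Fin 6) :
    frameDet (actFrames M f) i j = M.det * frameDet f i j :=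
  det2_mulVec M _ _ _ _

theorem actFrames_mem {M : Matrix (Fin 4) (Fin 4) ℝ} (hM : M.det ≠ 0) {f : Frames}
    (hf : f ∈ skewFrames) : actFrames M f ∈ skewFrames := by
  intro i j hij
  rw [frameDet_actFrames]
  exact mul_ne_zero hM (hf i j hij)

theorem joinedIn_mul {A B A' B' : Matrix (Fin 4) (Fin 4) ℝ}
    (h : JoinedIn {M : Matrix (Fin 4) (Fin 4) ℝ | M.det ≠ 0} A B)
    (h' : JoinedIn {M : Matrix (Fin 4) (Fin 4) ℝ | M.det ≠ 0} A' B') :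
    JoinedIn {M : Matrix (Fin 4) (Fin 4) ℝ | M.det ≠ 0} (A * A') (B * B') := by
  refine (h.mul h').mono ?_
  rintro _ ⟨M, hM, M', hM', rfl⟩
  simp only [Set.mem_ofPred_eq, Matrix.det_mul]
  exact mul_ne_zero hM hM'

theorem joinedIn_prod_transvections (L : List (Matrix.TransvectionStruct (Fin 4) ℝ)) :
    JoinedIn {M : Matrix (Fin 4) (Fin 4) ℝ | M.det ≠ 0}
      (L.map Matrix.TransvectionStruct.toMatrix).prod 1 := by
  induction L with
  | nil => exact JoinedIn.refl (by simp)
  | cons t L ih =>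
    rw [List.map_cons, List.prod_cons, ← mul_one (1 : Matrix (Fin 4) (Fin 4) ℝ)]
    refine joinedIn_mul ?_ ih
    refine JoinedIn.ofLine (f := fun τ : ℝ => Matrix.transvection t.i t.j ((1 - τ) * t.c))
      ?_ (by simp [Matrix.TransvectionStruct.toMatrix]) (by simp [Matrix.transvection]) ?_
    · refine (continuous_const.add (continuous_matrix fun a b => ?_)).continuousOn
      simp only [Matrix.single_apply]
      split_ifs <;> fun_prop
    · rintro _ ⟨τ, -, rfl⟩
      simp [Matrix.det_transvection_of_ne _ _ t.hij]

theorem joinedIn_diagonal {M : Matrix (Fin 4) (Fin 4) ℝ} (hM : M.det ≠ 0) :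
    ∃ d : Fin 4 → ℝ, JoinedIn {M : Matrix (Fin 4) (Fin 4) ℝ | M.det ≠ 0} M
      (Matrix.diagonal d) := by
  obtain ⟨L, L', d, h⟩ := Matrix.Pivot.exists_list_transvec_mul_diagonal_mul_list_transvec M
  have hd : (Matrix.diagonal d).det ≠ 0 := by
    intro h0
    apply hM
    rw [h, Matrix.det_mul, Matrix.det_mul, h0]
    simp
  refine ⟨d, ?_⟩
  have := joinedIn_mul (joinedIn_mul (joinedIn_prod_transvections L) (JoinedIn.refl hd))
    (joinedIn_prod_transvections L')
  rwa [one_mul, mul_one, ← h] at this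

theorem actFrames_diagonal_transversalFrames (d : Fin 4 → ℝ) (y₀ s z₀ : ℝ) (x y z w : Fin 5 → ℝ)
    (t t' : ℝ) : actFrames (Matrix.diagonal d) (transversalFrames y₀ s z₀ x y z w t t') =
      transversalFrames (d 1 * y₀) (d 0 * s) (d 2 * z₀) (fun j => d 0 * x j) (fun j => d 1 * y j)
        (fun j => d 2 * z j) (fun j => d 3 * w j) (d 2 * t) (d 3 * t') := by
  have hv : ∀ a b c e : ℝ, (Matrix.diagonal d).mulVec ![a, b, c, e] =
      ![d 0 * a, d 1 * b, d 2 * c, d 3 * e] := by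
    intro a b c e
    ext i
    fin_cases i <;> simp [Matrix.mulVec_diagonal]
  funext i
  refine Fin.cases ?_ (fun j => ?_) i
  · simp [actFrames, transversalFrames, hv]
  · simp [actFrames, transversalFrames, hv]

theorem actFrames_transversalFrames_equiv {M : Matrix (Fin 4) (Fin 4) ℝ} (hM : M.det ≠ 0)
    {y₀ s z₀ : ℝ} {x y z w : Fin 5 → ℝ} {t t' : ℝ}
    (h : actFrames M (transversalFrames y₀ s z₀ x y z w t t') ∈ skewFrames)
    (hb : BipartiteSigns (frameSign (actFrames M (transversalFrames y₀ s z₀ x y z w t t')))) :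
    FrameEquiv (actFrames M (transversalFrames y₀ s z₀ x y z w t t'))
      (permFrames (Equiv.swap 3 5)) := by
  set f := transversalFrames y₀ s z₀ x y z w t t' with hf
  have hfm : f ∈ skewFrames := by
    intro i j hij h0
    apply h i j hij
    rw [frameDet_actFrames, h0, mul_zero]
  obtain ⟨d, hd⟩ := joinedIn_diagonal hM
  have hc : Continuous fun M => actFrames M f := by
    unfold actFrames
    fun_prop
  have hj : JoinedIn skewFrames (actFrames M f) (actFrames (Matrix.diagonal d) f) := by
    refine (hd.map hc).mono ?_
    rintro _ ⟨N, hN, rfl⟩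
    exact actFrames_mem hN hfm
  have h1 := FrameEquiv.of_joinedIn hj
  rw [hf, actFrames_diagonal_transversalFrames] at h1
  exact h1.trans (transversalFrames_equiv h1.right_mem (h1.bipartiteSigns hb))

theorem linearIndependent_pair_of_isLine {a b : V4} (h : IsLine (span ℝ {a, b})) :
    LinearIndependent ℝ ![a, b] := by
  rw [linearIndependent_iff_card_eq_finrank_span, Set.finrank, Matrix.range_cons,
    Matrix.range_cons, Matrix.range_empty, Set.union_empty, Set.singleton_union, h]
  simp

theorem isLine_of_linearIndependent {a b : V4} (h : LinearIndependent ℝ ![a, b]) :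
    IsLine (span ℝ {a, b}) := by
  have := finrank_span_eq_card h
  rwa [Matrix.range_cons, Matrix.range_cons, Matrix.range_empty, Set.union_empty,
    Set.singleton_union] at this

theorem vecMul_of_four (v : Fin 4 → ℝ) (a b c d : V4) :
    Matrix.vecMul v (Matrix.of ![a, b, c, d]) = (v 0 • a + v 1 • b) + (v 2 • c + v 3 • d) := by
  ext i
  simp [Matrix.vecMul, dotProduct, Fin.sum_univ_four]
  ring

theorem det2_ne_zero_of_skew {a b c d : V4} (h : Skew (span ℝ {a, b}) (span ℝ {c, d})) :
    det2 a b c d ≠ 0 := by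
  intro h0
  obtain ⟨v, hv, hv0⟩ := Matrix.exists_vecMul_eq_zero_iff.2 h0
  rw [vecMul_of_four] at hv0
  have h1 : v 0 • a + v 1 • b ∈ span ℝ {a, b} := mem_span_pair.2 ⟨_, _, rfl⟩
  have h2 : v 2 • c + v 3 • d ∈ span ℝ {c, d} := mem_span_pair.2 ⟨_, _, rfl⟩
  have h3 : v 0 • a + v 1 • b ∈ span ℝ {a, b} ⊓ span ℝ {c, d} := by
    refine ⟨h1, ?_⟩
    rw [eq_neg_of_add_eq_zero_left hv0]
    exact neg_mem h2
  rw [h.2.2, mem_bot] at h3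
  rw [h3, zero_add] at hv0
  obtain ⟨e0, e1⟩ := LinearIndependent.pair_iff.1 (linearIndependent_pair_of_isLine h.1) _ _ h3
  obtain ⟨e2, e3⟩ := LinearIndependent.pair_iff.1 (linearIndependent_pair_of_isLine h.2.1) _ _ hv0
  apply hv
  ext i
  fin_cases i <;> simp [e0, e1, e2, e3]

theorem skew_of_det2_ne_zero {a b c d : V4} (h : det2 a b c d ≠ 0) :
    Skew (span ℝ {a, b}) (span ℝ {c, d}) := by
  have key : ∀ v : Fin 4 → ℝ, (v 0 • a + v 1 • b) + (v 2 • c + v 3 • d) = 0 → v = 0 := by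
    intro v hv
    by_contra hne
    exact h (Matrix.exists_vecMul_eq_zero_iff.1 ⟨v, hne, by rw [vecMul_of_four, hv]⟩)
  refine ⟨isLine_of_linearIndependent (LinearIndependent.pair_iff.2 fun p q hpq => ?_),
    isLine_of_linearIndependent (LinearIndependent.pair_iff.2 fun p q hpq => ?_), ?_⟩
  · have := key ![p, q, 0, 0] (by simpa using hpq)
    exact ⟨congrFun this 0, congrFun this 1⟩
  · have := key ![0, 0, p, q] (by simpa using hpq)
    exact ⟨congrFun this 2, congrFun this 3⟩
  · rw [eq_bot_iff]
    rintro x ⟨hx, hx'⟩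
    obtain ⟨p, q, rfl⟩ := mem_span_pair.1 hx
    obtain ⟨r, s, hrs⟩ := mem_span_pair.1 hx'
    have := key ![p, q, -r, -s] (by simp [← hrs]; abel)
    rw [show p = 0 from congrFun this 0, show q = 0 from congrFun this 1]
    simp

theorem IsLine.exists_span {P : PLine} (h : IsLine P) : ∃ a b : V4, P = span ℝ {a, b} := by
  let e := Module.finBasisOfFinrankEq ℝ P h
  refine ⟨e 0, e 1, ?_⟩
  have h1 : span ℝ (Set.range e) = ⊤ := e.span_eq
  have h2 := congrArg (Submodule.map P.subtype) h1
  rw [Submodule.map_span, Submodule.map_top, Submodule.range_subtype] at h2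
  refine h2.symm.trans (congrArg _ ?_)
  ext x
  simp [Fin.exists_fin_two, eq_comm]

theorem exists_det2_eq_mul {a b a' b' : V4} (h : span ℝ {a, b} = span ℝ {a', b'}) :
    ∃ c : ℝ, ∀ x y, det2 a' b' x y = c * det2 a b x y ∧ det2 x y a' b' = c * det2 x y a b := by
  have ha : a' ∈ span ℝ {a, b} := h ▸ subset_span (by simp)
  have hb : b' ∈ span ℝ {a, b} := h ▸ subset_span (by simp)
  obtain ⟨p, q, rfl⟩ := mem_span_pair.1 ha
  obtain ⟨r, s, rfl⟩ := mem_span_pair.1 hb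
  refine ⟨p * s - q * r, fun x y => ⟨?_, ?_⟩⟩ <;>
    simp only [det2_eq, Pi.add_apply, Pi.smul_apply, smul_eq_mul] <;> ring

theorem lk_span {a b c d e f : V4} (h1 : det2 a b c d ≠ 0)
    (h3 : det2 c d e f ≠ 0) : lk (span ℝ {a, b}) (span ℝ {c, d}) (span ℝ {e, f}) =
      SignType.sign (det2 a b c d * det2 a b e f * det2 c d e f) := by
  have hex : ∃ v : Fin 6 → V4, span ℝ {a, b} = span ℝ {v 0, v 1} ∧
      span ℝ {c, d} = span ℝ {v 2, v 3} ∧ span ℝ {e, f} = span ℝ {v 4, v 5} :=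
    ⟨![a, b, c, d, e, f], rfl, rfl, rfl⟩
  rw [lk, dif_pos hex]
  obtain ⟨hP, hQ, hR⟩ := hex.choose_spec
  generalize hex.choose = v at *
  obtain ⟨p, hp⟩ := exists_det2_eq_mul hP
  obtain ⟨q, hq⟩ := exists_det2_eq_mul hQ
  obtain ⟨r, hr⟩ := exists_det2_eq_mul hR
  have n1 : det2 (v 0) (v 1) (v 2) (v 3) ≠ 0 := det2_ne_zero_of_skew (by
    rw [← hP, ← hQ]; exact skew_of_det2_ne_zero h1)
  have n2 : det2 (v 2) (v 3) (v 4) (v 5) ≠ 0 := det2_ne_zero_of_skew (by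
    rw [← hQ, ← hR]; exact skew_of_det2_ne_zero h3)
  have e1 : det2 (v 0) (v 1) (v 2) (v 3) = p * q * det2 a b c d := by
    rw [(hp _ _).1, (hq _ _).2]; ring
  have e2 : det2 (v 0) (v 1) (v 4) (v 5) = p * r * det2 a b e f := by
    rw [(hp _ _).1, (hr _ _).2]; ring
  have e3 : det2 (v 2) (v 3) (v 4) (v 5) = q * r * det2 c d e f := by
    rw [(hq _ _).1, (hr _ _).2]; ring
  have hpqr : p * q * r ≠ 0 := by
    rw [e1] at n1
    rw [e3] at n2
    exact mul_ne_zero (left_ne_zero_of_mul n1) (right_ne_zero_of_mul (left_ne_zero_of_mul n2))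
  rw [e1, e2, e3, show p * q * det2 a b c d * (p * r * det2 a b e f) * (q * r * det2 c d e f) =
    ((p * q * r) * (p * q * r)) * (det2 a b c d * det2 a b e f * det2 c d e f) by ring]
  have hpos := mul_self_pos.2 hpqr
  rcases lt_trichotomy (det2 a b c d * det2 a b e f * det2 c d e f) 0 with hX | hX | hX
  · rw [Real.sign_of_neg (mul_neg_of_pos_of_neg hpos hX), sign_neg hX]; simp
  · rw [hX]; simp
  · rw [Real.sign_of_pos (mul_pos hpos hX), sign_pos hX]; simp

theorem exists_frames {L : Fin 6 → PLine} (hL : PairwiseSkew L) :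
    ∃ f ∈ skewFrames, L = frameLines f := by
  have hline : ∀ i, IsLine (L i) := fun i => by
    obtain ⟨j, hj⟩ := exists_ne i
    exact (hL i j hj.symm).1
  choose a b h using fun i => (hline i).exists_span
  refine ⟨fun i => (a i, b i), fun i j hij => det2_ne_zero_of_skew ?_, funext h⟩
  rw [← h, ← h]
  exact hL i j hij

theorem lk_frameLines {f : Frames} (hf : f ∈ skewFrames) {i j k : Fin 6} (hij : i ≠ j)
    (hjk : j ≠ k) : lk (frameLines f i) (frameLines f j) (frameLines f k) =
      ((frameSign f i j * frameSign f j k * frameSign f i k : ℤ) : ℝ) := by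
  rw [frameLines, frameLines, frameLines, lk_span (hf i j hij) (hf j k hjk)]
  simp only [frameSign, frameDet, _root_.sign_mul, SignType.coe_mul, Int.cast_mul]
  have : ∀ x : ℝ, ((SignType.sign x : SignType) : ℝ) = ((SignType.sign x : ℤ) : ℝ) := by
    intro x
    rcases lt_trichotomy x 0 with h | h | h <;> simp [h]
  simp only [this]
  ring

theorem bipartiteSigns_of_sgnOf {f : Frames} (hf : f ∈ skewFrames)
    (hsig : ∀ i : Fin 6, |sgnOf (frameLines f ∘ i.succAbove)| = 4) :
    BipartiteSigns (frameSign f) := by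
  rw [bipartiteSigns_iff (frameSign_symm _) (frameSign_self _)]
  intro m
  have h := hsig m
  have hne : ∀ {i j : Fin 5}, i ≠ j → m.succAbove i ≠ m.succAbove j :=
    fun h => Fin.succAbove_right_injective.ne h
  have key : ∀ i j k : Fin 5, (if i < j ∧ j < k then lk ((frameLines f ∘ m.succAbove) i)
      ((frameLines f ∘ m.succAbove) j) ((frameLines f ∘ m.succAbove) k) else 0) =
      if i < j ∧ j < k then ((frameSign f (m.succAbove i) (m.succAbove j) *
        frameSign f (m.succAbove j) (m.succAbove k) *
        frameSign f (m.succAbove i) (m.succAbove k) : ℤ) : ℝ) else 0 := by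
    intro i j k
    split_ifs with hijk
    · exact lk_frameLines hf (hne hijk.1.ne) (hne hijk.2.ne)
    · rfl
  simp only [sgnOf, key] at h
  set S := fun i j => frameSign f (m.succAbove i) (m.succAbove j) with hS
  have h' : |((tripleSum (S 0 1) (S 0 2) (S 0 3) (S 0 4) (S 1 2) (S 1 3) (S 1 4) (S 2 3) (S 2 4)
      (S 3 4) : ℤ) : ℝ)| = 4 := by
    rw [← h]
    congr 1
    simp only [Fin.sum_univ_five, tripleSum, hS]
    norm_num [Fin.lt_def]
    ring
  exact_mod_cast h'

theorem frameLines_rescale {c d : Fin 6 → ℝ} (hc : ∀ i, c i ≠ 0) (hd : ∀ i, d i ≠ 0)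
    (f : Frames) : frameLines (rescale c d f) = frameLines f := by
  funext i
  simp only [frameLines, rescale]
  rw [span_insert, span_insert, span_singleton_smul_eq (hc i).isUnit,
    span_singleton_smul_eq (hd i).isUnit]

theorem JoinedIn.deformation {f g : Frames} (h : JoinedIn skewFrames f g) :
    Deformation (frameLines f) (frameLines g) := by
  obtain ⟨γ, hγ⟩ := h
  have hc : Continuous γ.extend := γ.continuous_extend
  refine ⟨fun t => frameLines (γ.extend t), fun i => ⟨fun t => (γ.extend t i).1,
    fun t => (γ.extend t i).2, (by fun_prop), (by fun_prop), fun _ _ => rfl⟩,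
    fun t ht i j hij => ?_, by simp, by simp⟩
  refine skew_of_det2_ne_zero ?_
  rw [γ.extend_apply ht]
  exact hγ _ i j hij

theorem FrameEquiv.deformEquiv {f g : Frames} (h : FrameEquiv f g) :
    DeformEquiv (frameLines f) (frameLines g) := by
  obtain ⟨π, c, d, hc, hd, hj⟩ := h
  refine ⟨1, π, ?_⟩
  have := hj.deformation
  rwa [frameLines_rescale hc hd] at this

theorem DeformEquiv.of_comp_perm {n : ℕ} {L L' : Fin n → PLine} (ρ : Equiv.Perm (Fin n))
    (h : DeformEquiv (L ∘ ρ) L') : DeformEquiv L L' := by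
  obtain ⟨π, π', h⟩ := h
  exact ⟨ρ * π, π', h⟩

theorem frameLines_permFrames (p : Equiv.Perm (Fin 6)) :
    frameLines (permFrames p) = joinConfig p := rfl

theorem IsLine.eq_span_pair {P : PLine} (h : IsLine P) {a b : V4} (ha : a ∈ P) (hb : b ∈ P)
    (hab : LinearIndependent ℝ ![a, b]) : P = span ℝ {a, b} := by
  have hle : span ℝ {a, b} ≤ P := by
    rw [span_le]
    rintro x (rfl | rfl)
    exacts [ha, hb]
  refine (Submodule.eq_of_le_of_finrank_eq hle ?_).symm
  rw [show Module.finrank ℝ P = 2 from h]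
  exact isLine_of_linearIndependent hab

theorem IsLine.exists_span_right {P : PLine} (h : IsLine P) {b : V4} (hb : b ∈ P) (hb0 : b ≠ 0) :
    ∃ a ∈ P, P = span ℝ {a, b} := by
  by_contra! hcon
  have hle : P ≤ span ℝ {b} := by
    intro a ha
    by_contra hab
    refine hcon a ha (h.eq_span_pair ha hb ?_)
    rw [LinearIndependent.pair_iff]
    intro s t hst
    have hs : s = 0 := by
      by_contra hs
      apply hab
      refine mem_span_singleton.2 ⟨-(s⁻¹ * t), ?_⟩
      have h2 : s • a = -(t • b) := eq_neg_of_add_eq_zero_left hst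
      rw [neg_smul, mul_smul, ← smul_neg, ← h2, smul_smul, inv_mul_cancel₀ hs, one_smul]
    subst hs
    simpa [hb0] using hst
  have h1 := Submodule.finrank_mono hle
  rw [show Module.finrank ℝ P = 2 from h, finrank_span_singleton hb0] at h1
  omega

theorem linearIndependent_of_mem_of_mem {A B : PLine} (hAB : A ⊓ B = ⊥) {a b : V4} (ha : a ∈ A)
    (hb : b ∈ B) (ha0 : a ≠ 0) (hb0 : b ≠ 0) : LinearIndependent ℝ ![a, b] := by
  rw [LinearIndependent.pair_iff]
  intro s t hst
  have h1 : s • a ∈ A ⊓ B := by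
    refine ⟨A.smul_mem s ha, ?_⟩
    rw [eq_neg_of_add_eq_zero_left hst]
    exact B.neg_mem (B.smul_mem t hb)
  rw [hAB, mem_bot] at h1
  rw [h1, zero_add] at hst
  exact ⟨(smul_eq_zero.1 h1).resolve_right ha0, (smul_eq_zero.1 hst).resolve_right hb0⟩

theorem Skew.sup_eq_top {A B : PLine} (h : Skew A B) : A ⊔ B = ⊤ := by
  apply Submodule.eq_top_of_finrank_eq
  have h1 := Submodule.finrank_sup_add_finrank_inf_eq A B
  rw [h.2.2, finrank_bot, show Module.finrank ℝ A = 2 from h.1,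
    show Module.finrank ℝ B = 2 from h.2.1] at h1
  simpa using h1

/-- Six skew lines with two common transversals for four of them, one also meeting the fifth and
the other meeting the sixth line, have frames of the form `transversalFrames`. -/
theorem exists_transversalFrames {L : Fin 6 → PLine} (hL : PairwiseSkew L) {A B : PLine}
    (hAB : Skew A B) (hA : ∀ i, i ≠ 5 → ∃ a ∈ A, a ∈ L i ∧ a ≠ 0)
    (hB : ∀ i, i ≠ 0 → ∃ b ∈ B, b ∈ L i ∧ b ≠ 0) :
    ∃ (M : Matrix (Fin 4) (Fin 4) ℝ) (y₀ s z₀ : ℝ) (x y z w : Fin 5 → ℝ) (t t' : ℝ),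
      M.det ≠ 0 ∧ L = frameLines (actFrames M (transversalFrames y₀ s z₀ x y z w t t')) := by
  have hline : ∀ i, IsLine (L i) := fun i => by
    obtain ⟨j, hj⟩ := exists_ne i
    exact (hL i j hj.symm).1
  obtain ⟨a₀, ha₀A, ha₀L, ha₀⟩ := hA 0 (by decide)
  obtain ⟨eₓ, heₓ, hAspan⟩ := hAB.1.exists_span_right ha₀A ha₀
  obtain ⟨u, hu, hL0⟩ := (hline 0).exists_span_right ha₀L ha₀
  obtain ⟨uA, huA, uB, huB, rfl⟩ := mem_sup.1 (hAB.sup_eq_top ▸ mem_top : u ∈ A ⊔ B)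
  have huB0 : uB ≠ 0 := by
    rintro rfl
    obtain ⟨a, haA, haL, ha⟩ := hA 1 (by decide)
    have h1 : L 0 ≤ A := by
      rw [hL0, span_le]
      rintro x (rfl | rfl)
      · simpa using huA
      · exact ha₀A
    have h2 : L 0 = A := Submodule.eq_of_le_of_finrank_eq h1 ((hline 0).trans hAB.1.symm)
    have h3 : a ∈ L 0 ⊓ L 1 := ⟨h2 ▸ haA, haL⟩
    rw [(hL 0 1 (by decide)).2.2] at h3
    exact ha (by simpa using h3)
  obtain ⟨s, q, hsq⟩ := mem_span_pair.1 (hAspan ▸ huA)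
  obtain ⟨e_w, hew, hBspan⟩ := hAB.2.1.exists_span_right huB huB0
  set M := (Matrix.of ![eₓ, a₀, uB, e_w]).transpose with hM
  have hMdet : M.det ≠ 0 := by
    rw [hM, Matrix.det_transpose]
    refine det2_ne_zero_of_skew ?_
    rw [← hAspan, Set.pair_comm, ← hBspan]
    exact hAB
  have hMv : ∀ a b c d : ℝ, M.mulVec ![a, b, c, d] =
      (a • eₓ + b • a₀) + (c • uB + d • e_w) := by
    intro a b c d
    rw [hM, Matrix.mulVec_transpose, vecMul_of_four]
    simp
  have hMsurj : ∀ v : V4, ∃ a b c d, v = M.mulVec ![a, b, c, d] := by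
    intro v
    refine ⟨(M⁻¹.mulVec v) 0, (M⁻¹.mulVec v) 1, (M⁻¹.mulVec v) 2, (M⁻¹.mulVec v) 3, ?_⟩
    have : ![(M⁻¹.mulVec v) 0, (M⁻¹.mulVec v) 1, (M⁻¹.mulVec v) 2, (M⁻¹.mulVec v) 3] =
        M⁻¹.mulVec v := by
      ext i; fin_cases i <;> rfl
    rw [this, Matrix.mulVec_mulVec, Matrix.mul_nonsing_inv _ hMdet.isUnit, Matrix.one_mulVec]
  have hcoord : ∀ j : Fin 5, ∃ x y p p' z w : ℝ, (j ≠ 4 → p = 0 ∧ p' = 0) ∧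
      L j.succ = span ℝ {M.mulVec ![x, y, p, p'], M.mulVec ![0, 0, z, w]} := by
    intro j
    obtain ⟨b, hbB, hbL, hb⟩ := hB j.succ (Fin.succ_ne_zero j)
    obtain ⟨w, z, hzw⟩ := mem_span_pair.1 (hBspan ▸ hbB)
    have hbM : b = M.mulVec ![0, 0, z, w] := by
      rw [hMv, ← hzw]; module
    by_cases hj : j = 4
    · obtain ⟨v, -, hv⟩ := (hline j.succ).exists_span_right hbL hb
      obtain ⟨x, y, p, p', rfl⟩ := hMsurj v
      exact ⟨x, y, p, p', z, w, fun h => (h hj).elim, hbM ▸ hv⟩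
    · obtain ⟨a, haA, haL, ha⟩ := hA j.succ (fun h => hj (Fin.succ_injective _ h))
      obtain ⟨x, y, hxy⟩ := mem_span_pair.1 (hAspan ▸ haA)
      have haM : a = M.mulVec ![x, y, 0, 0] := by
        rw [hMv, ← hxy]; module
      refine ⟨x, y, 0, 0, z, w, fun _ => ⟨rfl, rfl⟩, ?_⟩
      rw [← haM, ← hbM]
      exact (hline j.succ).eq_span_pair haL hbL
        (linearIndependent_of_mem_of_mem hAB.2.2 haA hbB ha hb)
  choose x y p p' z w hp hspan using hcoord
  refine ⟨M, 1, s, 1, x, y, z, w, p 4, p' 4, hMdet, ?_⟩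
  funext i
  refine Fin.cases ?_ (fun j => ?_) i
  · simp only [frameLines, actFrames, transversalFrames, Fin.cons_zero, hMv]
    have h1 : s • eₓ + (0 : ℝ) • a₀ + ((1 : ℝ) • uB + (0 : ℝ) • e_w) = (uA + uB) - q • a₀ := by
      rw [← hsq]; module
    have h2 : (0 : ℝ) • eₓ + (1 : ℝ) • a₀ + ((0 : ℝ) • uB + (0 : ℝ) • e_w) = a₀ := by module
    rw [h1, h2]
    refine (hline 0).eq_span_pair ha₀L ?_ ?_
    · exact sub_mem hu ((L 0).smul_mem q ha₀L)
    · have hli := linearIndependent_pair_of_isLine (hL0 ▸ hline 0)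
      rw [LinearIndependent.pair_iff] at hli ⊢
      intro c d hcd
      have h := hli d (c - d * q) (by rw [← hcd]; module)
      have h3 := h.2
      rw [h.1, zero_mul, sub_zero] at h3
      exact ⟨h3, h.1⟩
  · simp only [frameLines, actFrames, transversalFrames, Fin.cons_succ]
    rw [hspan j]
    by_cases hj : j = 4
    · subst hj; simp
    · simp [hj, hp j hj]

theorem pderiv_comm (F : MvPolynomial (Fin 4) ℝ) (i j : Fin 4) :
    MvPolynomial.pderiv i (MvPolynomial.pderiv j F) =
      MvPolynomial.pderiv j (MvPolynomial.pderiv i F) := by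
  ext m
  simp only [MvPolynomial.coeff_pderiv]
  rcases eq_or_ne i j with rfl | hij
  · rfl
  · rw [add_right_comm]
    simp only [Finsupp.add_apply, Finsupp.single_apply, hij, hij.symm, if_false, add_zero]
    ring

theorem eval_sum_mul_pderiv {F : MvPolynomial (Fin 4) ℝ} {n : ℕ} (hF : F.IsHomogeneous n)
    (z : V4) : ∑ i, z i * MvPolynomial.eval z (MvPolynomial.pderiv i F) =
      n * MvPolynomial.eval z F := by
  have h := congrArg (MvPolynomial.eval z) hF.sum_X_mul_pderiv
  simpa using h

/-- The polarization of a real cubic form, together with smoothness at its real points. -/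
theorem exists_polarization {F : MvPolynomial (Fin 4) ℝ} (hF : F.IsHomogeneous 3)
    (hsm : ∀ z : Fin 4 → ℂ, z ≠ 0 →
      MvPolynomial.eval z (MvPolynomial.map (algebraMap ℝ ℂ) F) = 0 →
      ∃ j : Fin 4,
        MvPolynomial.eval z (MvPolynomial.map (algebraMap ℝ ℂ) (MvPolynomial.pderiv j F)) ≠ 0) :
    ∃ T : V4 →ₗ[ℝ] V4 →ₗ[ℝ] V4 →ₗ[ℝ] ℝ,
      (∀ x y z, T x y z = T y x z) ∧ (∀ x y z, T x y z = T x z y) ∧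
      (∀ z, T z z z = 6 * MvPolynomial.eval z F) ∧ ∀ z, (∀ y, T y z z = 0) → z = 0 := by
  let c : Fin 4 → Fin 4 → Fin 4 → ℝ := fun i j k => MvPolynomial.eval 0
    (MvPolynomial.pderiv k (MvPolynomial.pderiv j (MvPolynomial.pderiv i F)))
  let T : V4 →ₗ[ℝ] V4 →ₗ[ℝ] V4 →ₗ[ℝ] ℝ :=
    ∑ i, ∑ j, ∑ k, c i j k • (LinearMap.proj i).smulRight
      ((LinearMap.proj j).smulRight (LinearMap.proj k : V4 →ₗ[ℝ] ℝ))
  have hT : ∀ x y z, T x y z = ∑ i, ∑ j, ∑ k, c i j k * (x i * (y j * z k)) := by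
    intro x y z
    simp [T, LinearMap.sum_apply]
  have h1 : ∀ i, (MvPolynomial.pderiv i F).IsHomogeneous 2 := fun i => hF.pderiv
  have h2 : ∀ i j, (MvPolynomial.pderiv j (MvPolynomial.pderiv i F)).IsHomogeneous 1 :=
    fun i j => (h1 i).pderiv
  have h3 : ∀ i j k (z : V4), MvPolynomial.eval z
      (MvPolynomial.pderiv k (MvPolynomial.pderiv j (MvPolynomial.pderiv i F))) = c i j k := by
    intro i j k z
    have h := (h2 i j).pderiv (i := k)
    rw [← MvPolynomial.totalDegree_zero_iff_isHomogeneous,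
      MvPolynomial.totalDegree_eq_zero_iff_eq_C] at h
    simp only [c]
    rw [h]
    simp
  have hq : ∀ i z, ∑ j, ∑ k, c i j k * (z j * z k) =
      2 * MvPolynomial.eval z (MvPolynomial.pderiv i F) := by
    intro i z
    have h := eval_sum_mul_pderiv (h1 i) z
    push_cast at h
    rw [← h]
    refine Finset.sum_congr rfl fun j _ => ?_
    have h' := eval_sum_mul_pderiv (h2 i j) z
    push_cast at h'
    rw [one_mul] at h'
    rw [← h', Finset.mul_sum]
    refine Finset.sum_congr rfl fun k _ => ?_
    rw [h3]
    ring
  have hTq : ∀ y z, T y z z = ∑ i, y i * (2 * MvPolynomial.eval z (MvPolynomial.pderiv i F)) := by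
    intro y z
    rw [hT]
    refine Finset.sum_congr rfl fun i _ => ?_
    rw [← hq, Finset.mul_sum]
    refine Finset.sum_congr rfl fun j _ => ?_
    rw [Finset.mul_sum]
    exact Finset.sum_congr rfl fun k _ => by ring
  have hcub : ∀ z, T z z z = 6 * MvPolynomial.eval z F := by
    intro z
    have h := eval_sum_mul_pderiv hF z
    push_cast at h
    rw [hTq]
    calc _ = 2 * ∑ i, z i * MvPolynomial.eval z (MvPolynomial.pderiv i F) := by
          rw [Finset.mul_sum]
          exact Finset.sum_congr rfl fun i _ => by ring
      _ = _ := by rw [h]; ring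
  refine ⟨T, ?_, ?_, hcub, ?_⟩
  · intro x y z
    rw [hT, hT, Finset.sum_comm]
    refine Finset.sum_congr rfl fun j _ => Finset.sum_congr rfl fun i _ =>
      Finset.sum_congr rfl fun k _ => ?_
    simp only [c]
    rw [pderiv_comm F j i]
    ring
  · intro x y z
    rw [hT, hT]
    refine Finset.sum_congr rfl fun i _ => ?_
    rw [Finset.sum_comm]
    refine Finset.sum_congr rfl fun k _ => Finset.sum_congr rfl fun j _ => ?_
    simp only [c]
    rw [pderiv_comm _ k j]
    ring
  · intro z hz
    by_contra hz0
    have hev : ∀ G : MvPolynomial (Fin 4) ℝ, MvPolynomial.eval (fun i => (z i : ℂ))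
        (MvPolynomial.map (algebraMap ℝ ℂ) G) = (MvPolynomial.eval z G : ℝ) := by
      intro G
      have := MvPolynomial.map_eval (algebraMap ℝ ℂ) z G
      rw [← Complex.coe_algebraMap, this]
      rfl
    obtain ⟨j, hj⟩ := hsm (fun i => (z i : ℂ))
      (fun h => hz0 (funext fun i => by simpa using congrFun h i))
      (by rw [hev]; have := hcub z; rw [hz] at this; norm_cast; linarith)
    apply hj
    rw [hev]
    have := hz (Pi.single j 1)
    rw [hTq, Finset.sum_eq_single j (fun i _ hij => by simp [hij]) (by simp)] at this
    norm_cast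
    simpa using this

/-- The bihomogeneous part of a cubic form vanishing on two coordinate lines. -/
def bicubic (P Q R S : Fin 3 → ℝ) (a b c d : ℝ) : ℝ :=
  (P 0 * a ^ 2 + 2 * P 1 * a * b + P 2 * b ^ 2) * c +
    (Q 0 * a ^ 2 + 2 * Q 1 * a * b + Q 2 * b ^ 2) * d +
    a * (R 0 * c ^ 2 + 2 * R 1 * c * d + R 2 * d ^ 2) +
    b * (S 0 * c ^ 2 + 2 * S 1 * c * d + S 2 * d ^ 2)

/-- The partial derivatives of `bicubic` have no common zero. -/
def SmoothBicubic (P Q R S : Fin 3 → ℝ) : Prop :=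
  ∀ a b c d : ℝ,
    2 * (P 0 * a + P 1 * b) * c + 2 * (Q 0 * a + Q 1 * b) * d +
      (R 0 * c ^ 2 + 2 * R 1 * c * d + R 2 * d ^ 2) = 0 →
    2 * (P 1 * a + P 2 * b) * c + 2 * (Q 1 * a + Q 2 * b) * d +
      (S 0 * c ^ 2 + 2 * S 1 * c * d + S 2 * d ^ 2) = 0 →
    (P 0 * a ^ 2 + 2 * P 1 * a * b + P 2 * b ^ 2) + 2 * a * (R 0 * c + R 1 * d) +
      2 * b * (S 0 * c + S 1 * d) = 0 →
    (Q 0 * a ^ 2 + 2 * Q 1 * a * b + Q 2 * b ^ 2) + 2 * a * (R 1 * c + R 2 * d) +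
      2 * b * (S 1 * c + S 2 * d) = 0 →
    a = 0 ∧ b = 0 ∧ c = 0 ∧ d = 0

/-- The cubic `f₂₁(p, p; p)`. -/
def diagCubic (P Q : Fin 3 → ℝ) (a b : ℝ) : ℝ :=
  P 0 * a ^ 3 + (2 * P 1 + Q 0) * a ^ 2 * b + (P 2 + 2 * Q 1) * a * b ^ 2 + Q 2 * b ^ 3

/-- The quadratic form `p ∧ M p` of the matrix `M = !![m, n; k, l]`. -/
def wedgeForm (m n k l : ℝ) (a b : ℝ) : ℝ := k * a ^ 2 + (l - m) * a * b - n * b ^ 2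

theorem binaryCubic_coeff_eq_zero {c₀ c₁ c₂ c₃ : ℝ}
    (h : ∀ a b : ℝ, c₀ * a ^ 3 + c₁ * a ^ 2 * b + c₂ * a * b ^ 2 + c₃ * b ^ 3 = 0) :
    c₀ = 0 ∧ c₁ = 0 ∧ c₂ = 0 ∧ c₃ = 0 := by
  have h1 := h 1 0
  have h2 := h 0 1
  have h3 := h 1 1
  have h4 := h 1 (-1)
  refine ⟨?_, ?_, ?_, ?_⟩ <;> linarith

theorem bicubic_diag_coeff {P Q R S : Fin 3 → ℝ} (h : ∀ a b, bicubic P Q R S a b a b = 0) :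
    P 0 + R 0 = 0 ∧ 2 * P 1 + Q 0 + 2 * R 1 + S 0 = 0 ∧
      P 2 + 2 * Q 1 + R 2 + 2 * S 1 = 0 ∧ Q 2 + S 2 = 0 := by
  refine binaryCubic_coeff_eq_zero fun a b => ?_
  rw [← h a b, bicubic]
  ring

/-- The diagonal cubic has no multiple zero. -/
theorem diagCubic_no_double_zero {P Q R S : Fin 3 → ℝ} (hs : SmoothBicubic P Q R S)
    (h : ∀ a b, bicubic P Q R S a b a b = 0) {a b : ℝ} (hab : a ≠ 0 ∨ b ≠ 0)
    (ha : 3 * P 0 * a ^ 2 + 2 * (2 * P 1 + Q 0) * a * b + (P 2 + 2 * Q 1) * b ^ 2 = 0)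
    (hb : (2 * P 1 + Q 0) * a ^ 2 + 2 * (P 2 + 2 * Q 1) * a * b + 3 * Q 2 * b ^ 2 = 0) :
    False := by
  obtain ⟨h0, h1, h2, h3⟩ := bicubic_diag_coeff h
  obtain ⟨A₁, hA₁⟩ : ∃ A, A = P 0 * a ^ 2 + 2 * P 1 * a * b + P 2 * b ^ 2 := ⟨_, rfl⟩
  obtain ⟨A₂, hA₂⟩ : ∃ A, A = Q 0 * a ^ 2 + 2 * Q 1 * a * b + Q 2 * b ^ 2 := ⟨_, rfl⟩
  obtain ⟨C₁, hC₁⟩ : ∃ C, C = R 0 * a ^ 2 + 2 * R 1 * a * b + R 2 * b ^ 2 := ⟨_, rfl⟩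
  obtain ⟨C₂, hC₂⟩ : ∃ C, C = S 0 * a ^ 2 + 2 * S 1 * a * b + S 2 * b ^ 2 := ⟨_, rfl⟩
  have hA : A₁ * a + A₂ * b = 0 := by
    rw [hA₁, hA₂]; linear_combination (a * ha + b * hb) / 3
  have hC : C₁ * a + C₂ * b = 0 := by
    rw [hC₁, hC₂]
    linear_combination -(a * ha + b * hb) / 3 + a ^ 3 * h0 + a ^ 2 * b * h1 + a * b ^ 2 * h2 +
      b ^ 3 * h3
  -- A multiple zero of the cubic makes the surface singular at `(u • p, v • p)`.
  have key : ∀ u v : ℝ, (u ≠ 0 ∨ v ≠ 0) → u * A₁ = v * C₁ → u * A₂ = v * C₂ → False := by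
    intro u v huv e1 e2
    obtain ⟨x1, x2, x3, x4⟩ := hs (u * a) (u * b) (v * a) (v * b)
      (by rw [hA₁, hC₁] at e1; linear_combination u * v * ha - v * e1)
      (by rw [hA₂, hC₂] at e2; linear_combination u * v * hb - v * e2)
      (by
        rw [hA₁, hC₁] at e1
        linear_combination u * e1 + u * v * (3 * a ^ 2 * h0 + 2 * a * b * h1 + b ^ 2 * h2 - ha))
      (by
        rw [hA₂, hC₂] at e2
        linear_combination u * e2 + u * v * (a ^ 2 * h1 + 2 * a * b * h2 + 3 * b ^ 2 * h3 - hb))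
    rcases hab with hp | hp <;> rcases huv with hq | hq <;>
      simp_all
  by_cases hz : A₁ = 0 ∧ A₂ = 0
  · exact key 1 0 (by simp) (by simp [hz.1]) (by simp [hz.2])
  rcases hab with hp | hp
  · have hA2 : A₂ ≠ 0 := by
      intro h'
      rw [h'] at hA
      exact hz ⟨by simpa [hp] using hA, h'⟩
    refine key C₂ A₂ (Or.inr hA2) (mul_right_cancel₀ hp ?_) (by ring)
    linear_combination C₂ * hA - A₂ * hC
  · have hA1 : A₁ ≠ 0 := by
      intro h'
      rw [h'] at hA
      exact hz ⟨h', by simpa [hp] using hA⟩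
    refine key C₁ A₁ (Or.inr hA1) (by ring) (mul_right_cancel₀ hp ?_)
    linear_combination C₁ * hA - A₁ * hC

/-- If the surface contains the line with matrix `M`, the diagonal cubic is a multiple of
`p ∧ M p`. -/
theorem exists_wedgeForm_dvd_diagCubic {P Q R S : Fin 3 → ℝ} (hd : ∀ a b, bicubic P Q R S a b a b = 0)
    {m n k l : ℝ} (h : ∀ a b, bicubic P Q R S a b (m * a + n * b) (k * a + l * b) = 0)
    (h1 : m * l - n * k ≠ 0) (h2 : (m - 1) * (l - 1) - n * k ≠ 0) :
    ∃ s t : ℝ, ∀ a b, diagCubic P Q a b = (s * a + t * b) * wedgeForm m n k l a b := by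
  obtain ⟨h0, h1', h2', h3⟩ := bicubic_diag_coeff hd
  have hR0 : R 0 = -P 0 := by linarith
  have hS0 : S 0 = -(2 * P 1 + Q 0 + 2 * R 1) := by linarith
  have hR2 : R 2 = -(P 2 + 2 * Q 1 + 2 * S 1) := by linarith
  have hS2 : S 2 = -Q 2 := by linarith
  simp only [bicubic, hR0, hS0, hR2, hS2] at h
  obtain ⟨E₀, E₁, E₂, E₃⟩ := binaryCubic_coeff_eq_zero
    (c₀ := P 0 * m + Q 0 * k + (-P 0 * m ^ 2 + 2 * R 1 * m * k - (P 2 + 2 * Q 1 + 2 * S 1) * k ^ 2))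
    (c₁ := P 0 * n + 2 * P 1 * m + Q 0 * l + 2 * Q 1 * k +
      (-2 * P 0 * m * n + 2 * R 1 * (m * l + n * k) - 2 * (P 2 + 2 * Q 1 + 2 * S 1) * k * l) +
      (-(2 * P 1 + Q 0 + 2 * R 1) * m ^ 2 + 2 * S 1 * m * k - Q 2 * k ^ 2))
    (c₂ := 2 * P 1 * n + P 2 * m + 2 * Q 1 * l + Q 2 * k +
      (-P 0 * n ^ 2 + 2 * R 1 * n * l - (P 2 + 2 * Q 1 + 2 * S 1) * l ^ 2) +
      (-2 * (2 * P 1 + Q 0 + 2 * R 1) * m * n + 2 * S 1 * (m * l + n * k) - 2 * Q 2 * k * l))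
    (c₃ := P 2 * n + Q 2 * l + (-(2 * P 1 + Q 0 + 2 * R 1) * n ^ 2 + 2 * S 1 * n * l - Q 2 * l ^ 2))
    (fun a b => by rw [← h a b]; ring)
  have hN : 3 * ((m * l - n * k) * ((m - 1) * (l - 1) - n * k)) ≠ 0 :=
    mul_ne_zero three_ne_zero (mul_ne_zero h1 h2)
  refine ⟨(
      2 * S 1 * k * m - 2 * S 1 * k * m ^ 2 + 2 * S 1 * k * l + 2 * S 1 * k * l * m -
      2 * S 1 * k * l ^ 2 - 6 * S 1 * k ^ 2 * n - 2 * R 1 * m ^ 2 + 2 * R 1 * m ^ 3 -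
      4 * R 1 * l * m + 4 * R 1 * l ^ 2 * m + 2 * R 1 * k * n + 4 * R 1 * k * m * n -
      2 * R 1 * k * l * n - Q 2 * k ^ 2 + Q 2 * k ^ 2 * m + Q 2 * k ^ 2 * l + 2 * Q 1 * k -
      2 * Q 1 * k * m + 4 * Q 1 * k * l * m - 2 * Q 1 * k * l ^ 2 - 6 * Q 1 * k ^ 2 * n -
      Q 0 * m ^ 2 + Q 0 * m ^ 3 - 2 * Q 0 * l - Q 0 * l * m + Q 0 * l * m ^ 2 + 2 * Q 0 * l ^ 2 +
      3 * Q 0 * k * n + P 2 * k * l + 2 * P 2 * k * l * m - P 2 * k * l ^ 2 - 3 * P 2 * k ^ 2 * n +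
      2 * P 1 * m - 4 * P 1 * m ^ 2 + 2 * P 1 * m ^ 3 - 2 * P 1 * l * m + 2 * P 1 * l * m ^ 2 -
      2 * P 0 * n + 3 * P 0 * m * n - P 0 * m ^ 2 * n + 2 * P 0 * l * n - 4 * P 0 * l * m * n +
      3 * P 0 * k * n ^ 2) /
      (3 * ((m * l - n * k) * ((m - 1) * (l - 1) - n * k))), (
      4 * S 1 * l * m - 4 * S 1 * l * m ^ 2 + 2 * S 1 * l ^ 2 - 2 * S 1 * l ^ 3 - 2 * S 1 * k * n +
      2 * S 1 * k * m * n - 4 * S 1 * k * l * n - 2 * R 1 * m * n + 2 * R 1 * m ^ 2 * n -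
      2 * R 1 * l * n - 2 * R 1 * l * m * n + 2 * R 1 * l ^ 2 * n + 6 * R 1 * k * n ^ 2 +
      2 * Q 2 * k - 2 * Q 2 * k * m - 3 * Q 2 * k * l + 4 * Q 2 * k * l * m + Q 2 * k * l ^ 2 -
      3 * Q 2 * k ^ 2 * n - 2 * Q 1 * l + 2 * Q 1 * l * m + 4 * Q 1 * l ^ 2 - 2 * Q 1 * l ^ 2 * m -
      2 * Q 1 * l ^ 3 - Q 0 * m * n + Q 0 * m ^ 2 * n - 2 * Q 0 * l * m * n + 3 * Q 0 * k * n ^ 2 +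
      2 * P 2 * m - 2 * P 2 * m ^ 2 + P 2 * l * m + P 2 * l ^ 2 - P 2 * l ^ 2 * m - P 2 * l ^ 3 -
      3 * P 2 * k * n - 2 * P 1 * n + 2 * P 1 * m ^ 2 * n + 2 * P 1 * l * n - 4 * P 1 * l * m * n +
      6 * P 1 * k * n ^ 2 + P 0 * n ^ 2 - P 0 * m * n ^ 2 - P 0 * l * n ^ 2) /
      (3 * ((m * l - n * k) * ((m - 1) * (l - 1) - n * k))), fun a b => ?_⟩
  rw [← mul_right_inj' hN, div_mul_eq_mul_div, div_mul_eq_mul_div, ← add_div, div_mul_eq_mul_div,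
    mul_div_cancel₀ _ hN, diagCubic, wedgeForm]
  linear_combination
    ((l - l ^ 2 - n * k) * a + (m * n + n * l - n) * b) *
        (3 * a ^ 2 * E₀ + 2 * a * b * E₁ + b ^ 2 * E₂) +
      ((m * k + k * l - k) * a + (m - m ^ 2 - n * k) * b) *
        (a ^ 2 * E₁ + 2 * a * b * E₂ + 3 * b ^ 2 * E₃)

/-- The diagonal cubic is the product of `s a + t b` and the quadratic form `k a² + e a b - n b²`. -/
def DiagFactor (P Q : Fin 3 → ℝ) (s t k e n : ℝ) : Prop :=
  P 0 = s * k ∧ 2 * P 1 + Q 0 = s * e + t * k ∧ P 2 + 2 * Q 1 = t * e - s * n ∧ Q 2 = -(t * n)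

theorem diagFactor_of_forall {P Q : Fin 3 → ℝ} {s t m n k l : ℝ}
    (h : ∀ a b, diagCubic P Q a b = (s * a + t * b) * wedgeForm m n k l a b) :
    DiagFactor P Q s t k (l - m) n := by
  obtain ⟨h0, h1, h2, h3⟩ := binaryCubic_coeff_eq_zero (c₀ := P 0 - s * k)
    (c₁ := 2 * P 1 + Q 0 - (s * (l - m) + t * k)) (c₂ := P 2 + 2 * Q 1 - (t * (l - m) - s * n))
    (c₃ := Q 2 + t * n) fun a b => by
      have := h a b
      rw [diagCubic, wedgeForm] at this
      linear_combination this
  exact ⟨by linarith, by linarith, by linarith, by linarith⟩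

theorem DiagFactor.not_common_zero {P Q R S : Fin 3 → ℝ} (hs : SmoothBicubic P Q R S)
    (hd : ∀ a b, bicubic P Q R S a b a b = 0)
    {s t k e n : ℝ} (h : DiagFactor P Q s t k e n) {a b : ℝ}
    (hab : a ≠ 0 ∨ b ≠ 0) (h1 : s * a + t * b = 0) (h2 : k * a ^ 2 + e * a * b - n * b ^ 2 = 0) :
    False := by
  obtain ⟨g0, g1, g2, g3⟩ := h
  refine diagCubic_no_double_zero hs hd hab ?_ ?_
  · rw [g1, g2, mul_assoc 3, g0]
    linear_combination s * h2 + (2 * k * a + e * b) * h1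
  · rw [g1, g2, mul_assoc 3, g3]
    linear_combination t * h2 + (e * a - 2 * n * b) * h1

theorem DiagFactor.disc_ne_zero {P Q R S : Fin 3 → ℝ} (hs : SmoothBicubic P Q R S)
    (hd : ∀ a b, bicubic P Q R S a b a b = 0)
    {s t k e n : ℝ} (h : DiagFactor P Q s t k e n) :
    e ^ 2 + 4 * k * n ≠ 0 := by
  intro h0
  obtain ⟨g0, g1, g2, g3⟩ := h
  have key : ∀ a b : ℝ, (a ≠ 0 ∨ b ≠ 0) → 2 * k * a + e * b = 0 → e * a - 2 * n * b = 0 →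
      False := by
    intro a b hab e1 e2
    refine diagCubic_no_double_zero hs hd hab ?_ ?_
    · rw [g1, g2, mul_assoc 3, g0]
      linear_combination (s * a / 2 + (s * a + t * b)) * e1 + s * b / 2 * e2
    · rw [g1, g2, mul_assoc 3, g3]
      linear_combination (t * a / 2) * e1 + (t * b / 2 + (s * a + t * b)) * e2
  by_cases hz : e = 0 ∧ k = 0
  · exact key 1 0 (by simp) (by simp [hz.2]) (by simp [hz.1])
  · refine key e (-2 * k) ?_ (by ring) (by linear_combination h0)
    by_contra! hc
    exact hz ⟨hc.1, by linarith [hc.2]⟩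

theorem DiagFactor.linear_ne_zero {P Q R S : Fin 3 → ℝ} (hs : SmoothBicubic P Q R S)
    (hd : ∀ a b, bicubic P Q R S a b a b = 0)
    {s t k e n : ℝ} (h : DiagFactor P Q s t k e n) :
    s ≠ 0 ∨ t ≠ 0 := by
  by_contra! hc
  obtain ⟨g0, g1, g2, g3⟩ := h
  simp only [hc.1, hc.2] at g0 g1
  refine diagCubic_no_double_zero hs hd (a := 1) (b := 0) (by simp) ?_ ?_
  · rw [g0]; ring
  · rw [g1]; ring

/-- If one of the quadratic factors splits, then so does the diagonal cubic. -/
theorem exists_three_zeros {P Q R S : Fin 3 → ℝ} (hs : SmoothBicubic P Q R S)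
    (hd : ∀ a b, bicubic P Q R S a b a b = 0)
    {s t k e n : Fin 3 → ℝ}
    (h : ∀ j, DiagFactor P Q (s j) (t j) (k j) (e j) (n j)) {j₀ : Fin 3}
    (hpos : 0 < e j₀ ^ 2 + 4 * k j₀ * n j₀) :
    ∃ x y : Fin 3 → ℝ, (∀ i j, i ≠ j → x i * y j - y i * x j ≠ 0) ∧
      ∀ j, ∃ o, ∀ i, i ≠ o → k j * x i ^ 2 + e j * x i * y i - n j * y i ^ 2 = 0 := by
  obtain ⟨x₁, y₁, x₂, y₂, hne, hz₁, hz₂⟩ : ∃ x₁ y₁ x₂ y₂ : ℝ, x₁ * y₂ - y₁ * x₂ ≠ 0 ∧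
      k j₀ * x₁ ^ 2 + e j₀ * x₁ * y₁ - n j₀ * y₁ ^ 2 = 0 ∧
      k j₀ * x₂ ^ 2 + e j₀ * x₂ * y₂ - n j₀ * y₂ ^ 2 = 0 := by
    obtain ⟨δ, hδ⟩ : ∃ δ, δ = √(e j₀ ^ 2 + 4 * k j₀ * n j₀) := ⟨_, rfl⟩
    have hδ2 : δ ^ 2 = e j₀ ^ 2 + 4 * k j₀ * n j₀ := by rw [hδ, Real.sq_sqrt hpos.le]
    have hδ0 : δ ≠ 0 := by rw [hδ]; exact (Real.sqrt_pos.2 hpos).ne'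
    by_cases hk : k j₀ = 0
    · rw [hk] at hδ2 ⊢
      have he : e j₀ ≠ 0 := fun he => hδ0 (by rw [he] at hδ2; simpa using hδ2)
      exact ⟨1, 0, n j₀, e j₀, by simpa using he, by simp, by ring⟩
    · refine ⟨-e j₀ + δ, 2 * k j₀, -e j₀ - δ, 2 * k j₀, ?_, ?_, ?_⟩
      · have : (-e j₀ + δ) * (2 * k j₀) - 2 * k j₀ * (-e j₀ - δ) = 4 * (k j₀ * δ) := by ring
        rw [this]
        positivity
      · linear_combination k j₀ * hδ2
      · linear_combination k j₀ * hδ2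
  have hp : ∀ {a b c d : ℝ}, a * d - b * c ≠ 0 → a ≠ 0 ∨ b ≠ 0 := by
    intro a b c d h
    by_contra! hc
    simp [hc.1, hc.2] at h
  have hne' : x₂ * y₁ - y₂ * x₁ ≠ 0 := fun h' => hne (by linear_combination -h')
  have hl₁ : s j₀ * x₁ + t j₀ * y₁ ≠ 0 := fun h' => (h j₀).not_common_zero hs hd (hp hne) h' hz₁
  have hl₂ : s j₀ * x₂ + t j₀ * y₂ ≠ 0 := fun h' => (h j₀).not_common_zero hs hd (hp hne') h' hz₂
  have hg : ∀ j a b, k j₀ * a ^ 2 + e j₀ * a * b - n j₀ * b ^ 2 = 0 ∨ s j₀ * a + t j₀ * b = 0 →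
      (s j * a + t j * b) * (k j * a ^ 2 + e j * a * b - n j * b ^ 2) = 0 := by
    intro j a b hab
    obtain ⟨g0, g1, g2, g3⟩ := h j
    obtain ⟨g0', g1', g2', g3'⟩ := h j₀
    have h0 : (s j₀ * a + t j₀ * b) * (k j₀ * a ^ 2 + e j₀ * a * b - n j₀ * b ^ 2) = 0 := by
      rcases hab with h0 | h0 <;> rw [h0] <;> ring
    linear_combination h0 + a ^ 3 * (g0' - g0) + a ^ 2 * b * (g1' - g1) + a * b ^ 2 * (g2' - g2) +
      b ^ 3 * (g3' - g3)
  obtain ⟨x, hx⟩ : ∃ x : Fin 3 → ℝ, x = ![x₁, x₂, t j₀] := ⟨_, rfl⟩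
  obtain ⟨y, hy⟩ : ∃ y : Fin 3 → ℝ, y = ![y₁, y₂, -s j₀] := ⟨_, rfl⟩
  have hxy : ∀ i j, i ≠ j → x i * y j - y i * x j ≠ 0 := by
    subst hx hy
    intro i j hij h'
    fin_cases i <;> fin_cases j <;> simp at hij h'
    · exact hne h'
    · exact hl₁ (by linear_combination -h')
    · exact hne' h'
    · exact hl₂ (by linear_combination -h')
    · exact hl₁ (by linear_combination h')
    · exact hl₂ (by linear_combination h')
  have hgx : ∀ j i, (s j * x i + t j * y i) *
      (k j * x i ^ 2 + e j * x i * y i - n j * y i ^ 2) = 0 := by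
    subst hx hy
    intro j i
    refine hg j _ _ ?_
    fin_cases i
    · exact Or.inl hz₁
    · exact Or.inl hz₂
    · right
      simp only [Fin.reduceFinMk, Matrix.cons_val]
      ring
  refine ⟨x, y, hxy, fun j => ?_⟩
  by_cases hall : ∀ i, k j * x i ^ 2 + e j * x i * y i - n j * y i ^ 2 = 0
  · exact ⟨0, fun i _ => hall i⟩
  push Not at hall
  obtain ⟨o, ho⟩ := hall
  refine ⟨o, fun i hi => by_contra fun hi0 => ?_⟩
  have e1 := (mul_eq_zero.1 (hgx j o)).resolve_right ho
  have e2 := (mul_eq_zero.1 (hgx j i)).resolve_right hi0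
  have hs0 : s j = 0 := (mul_eq_zero.1 (show s j * (x i * y o - y i * x o) = 0 by
    linear_combination y o * e2 - y i * e1)).resolve_right (hxy i o hi)
  have ht0 : t j = 0 := (mul_eq_zero.1 (show t j * (x i * y o - y i * x o) = 0 by
    linear_combination x i * e1 - x o * e2)).resolve_right (hxy i o hi)
  exact ((h j).linear_ne_zero hs hd).elim (fun h' => h' hs0) fun h' => h' ht0

theorem exists_eq_mul_of_disc_neg {P Q R S : Fin 3 → ℝ} (hs : SmoothBicubic P Q R S)
    (hd : ∀ a b, bicubic P Q R S a b a b = 0) {s t k e n s' t' k' e' n' : ℝ}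
    (h : DiagFactor P Q s t k e n) (h' : DiagFactor P Q s' t' k' e' n')
    (hneg : e ^ 2 + 4 * k * n < 0) : ∃ c, k' = c * k ∧ e' = c * e ∧ n' = c * n := by
  have hl := h'.linear_ne_zero hs hd
  obtain ⟨g0, g1, g2, g3⟩ := h
  obtain ⟨g0', g1', g2', g3'⟩ := h'
  have hdet : s * t' - t * s' = 0 := by
    have h0 : (s * t' - t * s') * (k * t' ^ 2 - e * t' * s' - n * s' ^ 2) = 0 := by
      linear_combination t' ^ 3 * (g0' - g0) - t' ^ 2 * s' * (g1' - g1) + t' * s' ^ 2 * (g2' - g2) -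
        s' ^ 3 * (g3' - g3)
    refine (mul_eq_zero.1 h0).resolve_right fun h1 => ?_
    have hk : k ≠ 0 := by
      rintro rfl
      nlinarith [sq_nonneg e]
    have h2 : (2 * k * t' - e * s') ^ 2 = (e ^ 2 + 4 * k * n) * s' ^ 2 := by
      linear_combination 4 * k * h1
    have hs' : s' = 0 := by
      by_contra hs'
      have := mul_neg_of_neg_of_pos hneg (by positivity : 0 < s' ^ 2)
      nlinarith [sq_nonneg (2 * k * t' - e * s')]
    rw [hs'] at h1
    have ht' : t' = 0 := by simpa [hk] using h1
    exact hl.elim (fun h => h hs') fun h => h ht'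
  by_cases hs' : s' = 0
  · have ht' : t' ≠ 0 := hl.resolve_left fun h => h hs'
    rw [hs'] at hdet g0' g1' g2'
    have hs0 : s = 0 := by simpa [ht'] using hdet
    rw [hs0] at g0 g1 g2
    refine ⟨t / t', ?_, ?_, ?_⟩ <;> field_simp <;> linarith
  · have hk : s' * k' = s * k := by linarith
    have he : s' * e' = s * e := mul_left_cancel₀ hs' (by
      linear_combination s' * (g1 - g1') - t' * hk - k * hdet)
    have hn : s' * n' = s * n := by
      refine mul_left_cancel₀ hs' ?_
      linear_combination s' * (g2' - g2) + t' * he + e * hdet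
    refine ⟨s / s', ?_, ?_, ?_⟩ <;> field_simp <;> linarith

theorem det_sub_nonneg_of_disc_neg {m n k l m' n' k' l' c : ℝ} (hneg : (l - m) ^ 2 + 4 * k * n < 0)
    (hk : k' = c * k) (he : l' - m' = c * (l - m)) (hn : n' = c * n) :
    0 ≤ (m' - m) * (l' - l) - (n' - n) * (k' - k) := by
  have h1 : l' = m' + c * (l - m) := by linarith
  subst hk hn h1
  have h2 : (m' - m) * (m' + c * (l - m) - l) - (c * n - n) * (c * k - k) =
      ((m' - m) + (c - 1) * (l - m) / 2) ^ 2 +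
        (c - 1) ^ 2 * (-((l - m) ^ 2 + 4 * k * n)) / 4 := by ring
  rw [h2]
  have := mul_nonneg (sq_nonneg (c - 1)) (neg_pos.2 hneg).le
  nlinarith [sq_nonneg ((m' - m) + (c - 1) * (l - m) / 2)]

theorem exists_comb_of_det2_ne_zero {v₁ v₂ w₁ w₂ : V4} (h : det2 v₁ v₂ w₁ w₂ ≠ 0) (y : V4) :
    ∃ a b c d : ℝ, y = a • v₁ + b • v₂ + (c • w₁ + d • w₂) := by
  obtain ⟨p, hp, q, hq, rfl⟩ := mem_sup.1 ((skew_of_det2_ne_zero h).sup_eq_top ▸ mem_top (x := y))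
  obtain ⟨a, b, rfl⟩ := mem_span_pair.1 hp
  obtain ⟨c, d, rfl⟩ := mem_span_pair.1 hq
  exact ⟨a, b, c, d, rfl⟩

theorem det2_add_smul_left (v₁ v₂ w₁ w₂ : V4) (a b c d : ℝ) :
    det2 (a • v₁ + b • v₂ + (c • w₁ + d • w₂)) v₂ w₁ w₂ = a * det2 v₁ v₂ w₁ w₂ := by
  simp only [det2_eq, Pi.add_apply, Pi.smul_apply, smul_eq_mul]
  ring

theorem det2_swap_left (a b c d : V4) : det2 b a c d = -det2 a b c d := by
  simp only [det2_eq]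
  ring

theorem det2_comm (a b c d : V4) : det2 c d a b = det2 a b c d := by
  simp only [det2_eq]
  ring

theorem comb_eq_zero_of_det2_ne_zero {v₁ v₂ w₁ w₂ : V4} (h : det2 v₁ v₂ w₁ w₂ ≠ 0) {a b c d : ℝ}
    (h0 : a • v₁ + b • v₂ + (c • w₁ + d • w₂) = 0) : a = 0 ∧ b = 0 ∧ c = 0 ∧ d = 0 := by
  have key : ∀ {v₁ v₂ w₁ w₂ : V4} {a b c d : ℝ}, det2 v₁ v₂ w₁ w₂ ≠ 0 →
      a • v₁ + b • v₂ + (c • w₁ + d • w₂) = 0 → a = 0 := by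
    intro v₁ v₂ w₁ w₂ a b c d h h0
    have h1 := det2_add_smul_left v₁ v₂ w₁ w₂ a b c d
    rw [h0] at h1
    have h2 : det2 0 v₂ w₁ w₂ = 0 := by simp [det2_eq]
    rw [h2] at h1
    exact (mul_eq_zero.1 h1.symm).resolve_right h
  have h' : det2 w₁ w₂ v₁ v₂ ≠ 0 := by rwa [det2_comm]
  refine ⟨key h h0, key (a := b) (b := a) (c := c) (d := d) ?_ (by rw [← h0]; abel),
    key (b := d) (c := a) (d := b) h' (by rw [← h0]; abel),
    key (a := d) (b := c) (c := a) (d := b) ?_ (by rw [← h0]; abel)⟩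
  · rw [det2_swap_left]
    exact neg_ne_zero.2 h
  · rw [det2_swap_left]
    exact neg_ne_zero.2 h'

theorem trilinear_comb {T : V4 →ₗ[ℝ] V4 →ₗ[ℝ] V4 →ₗ[ℝ] ℝ} (u v₁ v₂ w₁ w₂ : V4)
    (h2 : ∀ x y z, T x y z = T x z y) (a b c d : ℝ) :
    T u (a • v₁ + b • v₂ + (c • w₁ + d • w₂)) (a • v₁ + b • v₂ + (c • w₁ + d • w₂)) =
      a ^ 2 * T u v₁ v₁ + 2 * a * b * T u v₁ v₂ + b ^ 2 * T u v₂ v₂ +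
        2 * (a * c * T u v₁ w₁ + a * d * T u v₁ w₂ + b * c * T u v₂ w₁ + b * d * T u v₂ w₂) +
        (c ^ 2 * T u w₁ w₁ + 2 * c * d * T u w₁ w₂ + d ^ 2 * T u w₂ w₂) := by
  simp only [map_add, map_smul, LinearMap.add_apply, LinearMap.smul_apply, smul_eq_mul,
    h2 u v₂ v₁, h2 u w₁ v₁, h2 u w₂ v₁, h2 u w₁ v₂, h2 u w₂ v₂, h2 u w₂ w₁]
  ring

theorem trilinear_eq_zero_of_span {T : V4 →ₗ[ℝ] V4 →ₗ[ℝ] V4 →ₗ[ℝ] ℝ} {p q : V4}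
    (h1 : ∀ x y z, T x y z = T y x z) (h2 : ∀ x y z, T x y z = T x z y)
    (h : ∀ z ∈ span ℝ {p, q}, T z z z = 0) :
    T p p p = 0 ∧ T p p q = 0 ∧ T p q q = 0 ∧ T q q q = 0 := by
  obtain ⟨c0, c1, c2, c3⟩ := binaryCubic_coeff_eq_zero (c₀ := T p p p) (c₁ := 3 * T p p q)
    (c₂ := 3 * T p q q) (c₃ := T q q q) fun a b => by
      have := h (a • p + b • q) (mem_span_pair.2 ⟨a, b, rfl⟩)
      simp only [map_add, map_smul, LinearMap.add_apply, LinearMap.smul_apply, smul_eq_mul,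
        h1 q p, h2 p q p, h2 q q p] at this
      linear_combination this
  exact ⟨c0, by linarith, by linarith, c3⟩

theorem exists_smoothBicubic {T : V4 →ₗ[ℝ] V4 →ₗ[ℝ] V4 →ₗ[ℝ] ℝ}
    (h1 : ∀ x y z, T x y z = T y x z) (h2 : ∀ x y z, T x y z = T x z y)
    (hsm : ∀ z, (∀ y, T y z z = 0) → z = 0) {v₁ v₂ w₁ w₂ : V4} (hD : det2 v₁ v₂ w₁ w₂ ≠ 0)
    (hv : ∀ z ∈ span ℝ {v₁, v₂}, T z z z = 0) (hw : ∀ z ∈ span ℝ {w₁, w₂}, T z z z = 0) :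
    ∃ P Q R S : Fin 3 → ℝ, SmoothBicubic P Q R S ∧ ∀ a b c d,
      T (a • v₁ + b • v₂ + (c • w₁ + d • w₂)) (a • v₁ + b • v₂ + (c • w₁ + d • w₂))
        (a • v₁ + b • v₂ + (c • w₁ + d • w₂)) = 3 * bicubic P Q R S a b c d := by
  obtain ⟨hv0, hv1, hv2, hv3⟩ := trilinear_eq_zero_of_span h1 h2 hv
  obtain ⟨hw0, hw1, hw2, hw3⟩ := trilinear_eq_zero_of_span h1 h2 hw
  have e1 := fun a b c d => trilinear_comb v₁ v₁ v₂ w₁ w₂ h2 a b c d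
  have e2 := fun a b c d => trilinear_comb v₂ v₁ v₂ w₁ w₂ h2 a b c d
  have e3 := fun a b c d => trilinear_comb w₁ v₁ v₂ w₁ w₂ h2 a b c d
  have e4 := fun a b c d => trilinear_comb w₂ v₁ v₂ w₁ w₂ h2 a b c d
  simp only [h1 v₂ v₁, h1 w₁ v₁, h1 w₂ v₁, h1 w₁ v₂, h1 w₂ v₂, h1 w₂ w₁, h2 _ v₂ v₁, h2 _ w₁ v₁,
    h2 _ w₂ v₁, h2 _ w₁ v₂, h2 _ w₂ v₂, h2 _ w₂ w₁, hv0, hv1, hv2, hv3, hw0, hw1, hw2, hw3]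
    at e1 e2 e3 e4
  refine ⟨![T v₁ v₁ w₁, T v₁ v₂ w₁, T v₂ v₂ w₁], ![T v₁ v₁ w₂, T v₁ v₂ w₂, T v₂ v₂ w₂],
    ![T v₁ w₁ w₁, T v₁ w₁ w₂, T v₁ w₂ w₂], ![T v₂ w₁ w₁, T v₂ w₁ w₂, T v₂ w₂ w₂], ?_, ?_⟩
  · intro a b c d f1 f2 f3 f4
    simp only [Matrix.cons_val] at f1 f2 f3 f4
    refine comb_eq_zero_of_det2_ne_zero hD (hsm _ fun y => ?_)
    obtain ⟨a', b', c', d', rfl⟩ := exists_comb_of_det2_ne_zero hD y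
    have g1 := e1 a b c d
    have g2 := e2 a b c d
    have g3 := e3 a b c d
    have g4 := e4 a b c d
    generalize a • v₁ + b • v₂ + (c • w₁ + d • w₂) = z at *
    simp only [map_add, map_smul, LinearMap.add_apply, LinearMap.smul_apply, smul_eq_mul]
    linear_combination a' * (g1 + f1) + b' * (g2 + f2) + c' * (g3 + f3) + d' * (g4 + f4)
  · intro a b c d
    have g1 := e1 a b c d
    have g2 := e2 a b c d
    have g3 := e3 a b c d
    have g4 := e4 a b c d
    obtain ⟨z, hz⟩ : ∃ z, z = a • v₁ + b • v₂ + (c • w₁ + d • w₂) := ⟨_, rfl⟩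
    rw [← hz] at g1 g2 g3 g4 ⊢
    have : T z z z = a * T v₁ z z + b * T v₂ z z + (c * T w₁ z z + d * T w₂ z z) := by
      conv_lhs => rw [show T z = T (a • v₁ + b • v₂ + (c • w₁ + d • w₂)) by rw [hz]]
      simp only [map_add, map_smul, LinearMap.add_apply, LinearMap.smul_apply, smul_eq_mul]
    rw [this, g1, g2, g3, g4, bicubic]
    simp only [Matrix.cons_val]
    ring

theorem det2_graph (v₁ v₂ w₁ w₂ : V4) (m n k l m' n' k' l' : ℝ) :
    det2 (v₁ + (m • w₁ + k • w₂)) (v₂ + (n • w₁ + l • w₂)) (v₁ + (m' • w₁ + k' • w₂))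
      (v₂ + (n' • w₁ + l' • w₂)) =
      det2 v₁ v₂ w₁ w₂ * ((m' - m) * (l' - l) - (n' - n) * (k' - k)) := by
  simp only [det2_eq, Pi.add_apply, Pi.smul_apply, smul_eq_mul]
  ring

theorem det2_graph_right (v₁ v₂ w₁ w₂ : V4) (m n k l : ℝ) :
    det2 w₁ w₂ (v₁ + (m • w₁ + k • w₂)) (v₂ + (n • w₁ + l • w₂)) = det2 v₁ v₂ w₁ w₂ := by
  simp only [det2_eq, Pi.add_apply, Pi.smul_apply, smul_eq_mul]
  ring

/-- A line skew to `span {w₁, w₂}` is the graph of a matrix. -/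
theorem exists_graph {v₁ v₂ w₁ w₂ : V4} (h : det2 v₁ v₂ w₁ w₂ ≠ 0) {P : PLine}
    (hP : Skew (span ℝ {w₁, w₂}) P) : ∃ m n k l : ℝ,
      P = span ℝ {v₁ + (m • w₁ + k • w₂), v₂ + (n • w₁ + l • w₂)} := by
  have key : ∀ v : V4, ∃ a b : ℝ, v + (a • w₁ + b • w₂) ∈ P := by
    intro v
    obtain ⟨q, hq, p, hp, rfl⟩ := mem_sup.1 (hP.sup_eq_top ▸ mem_top (x := v))
    obtain ⟨a, b, rfl⟩ := mem_span_pair.1 hq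
    refine ⟨-a, -b, ?_⟩
    convert hp using 1
    module
  obtain ⟨m, k, h1⟩ := key v₁
  obtain ⟨n, l, h2⟩ := key v₂
  refine ⟨m, n, k, l, hP.2.1.eq_span_pair h1 h2 (linearIndependent_pair_of_isLine ?_)⟩
  exact (skew_of_det2_ne_zero ((det2_graph_right v₁ v₂ w₁ w₂ m n k l).trans_ne h)).2.1

/-- Coordinates in which the first three lines are standard and the others are graphs. -/
theorem exists_graph_coordinates {L : Fin 6 → PLine} (hL : PairwiseSkew L) :
    ∃ (v₁ v₂ w₁ w₂ : V4) (m n k l : Fin 3 → ℝ), det2 v₁ v₂ w₁ w₂ ≠ 0 ∧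
      L 0 = span ℝ {v₁, v₂} ∧ L 1 = span ℝ {w₁, w₂} ∧ L 2 = span ℝ {v₁ + w₁, v₂ + w₂} ∧
      ∀ j, L (Fin.natAdd 3 j) =
        span ℝ {v₁ + (m j • w₁ + k j • w₂), v₂ + (n j • w₁ + l j • w₂)} := by
  have h01 := hL 0 1 (by decide)
  obtain ⟨v₁, v₂, hv⟩ := h01.1.exists_span
  obtain ⟨u₁, u₂, hu⟩ := h01.2.1.exists_span
  have hD : det2 v₁ v₂ u₁ u₂ ≠ 0 := det2_ne_zero_of_skew (hv ▸ hu ▸ h01)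
  obtain ⟨a, b, c, d, h2⟩ := exists_graph hD (hu ▸ hL 1 2 (by decide))
  obtain ⟨w₁, hw₁⟩ : ∃ w, w = a • u₁ + c • u₂ := ⟨_, rfl⟩
  obtain ⟨w₂, hw₂⟩ : ∃ w, w = b • u₁ + d • u₂ := ⟨_, rfl⟩
  rw [← hw₁, ← hw₂] at h2
  have hD' : det2 v₁ v₂ w₁ w₂ ≠ 0 := by
    have h3 := det2_ne_zero_of_skew (hv ▸ h2 ▸ hL 0 2 (by decide))
    have h4 := det2_graph v₁ v₂ w₁ w₂ 0 0 0 0 1 0 0 1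
    simp only [zero_smul, one_smul, add_zero, zero_add] at h4
    rw [h4] at h3
    simpa using h3
  have hw : L 1 = span ℝ {w₁, w₂} := h01.2.1.eq_span_pair
    (hu ▸ mem_span_pair.2 ⟨a, c, hw₁.symm⟩) (hu ▸ mem_span_pair.2 ⟨b, d, hw₂.symm⟩)
    (linearIndependent_pair_of_isLine (skew_of_det2_ne_zero hD').2.1)
  have h3 : ∀ j : Fin 3, Skew (span ℝ {w₁, w₂}) (L (Fin.natAdd 3 j)) := fun j =>
    hw ▸ hL 1 _ (by fin_cases j <;> decide)
  choose m n k l hj using fun j => exists_graph hD' (h3 j)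
  exact ⟨v₁, v₂, w₁, w₂, m, n, k, l, hD', hv, hw, h2, hj⟩

/-- The transversal of the first three lines given by an eigenvector of each graph matrix meets
all of these graphs. -/
theorem exists_mem_transversal {v₁ v₂ w₁ w₂ : V4} (hD : det2 v₁ v₂ w₁ w₂ ≠ 0) {x y : ℝ}
    (hxy : x ≠ 0 ∨ y ≠ 0) {m n k l : ℝ} (h : wedgeForm m n k l x y = 0) :
    ∃ a ∈ span ℝ {x • v₁ + y • v₂, x • w₁ + y • w₂},
      a ∈ span ℝ {v₁ + (m • w₁ + k • w₂), v₂ + (n • w₁ + l • w₂)} ∧ a ≠ 0 := by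
  obtain ⟨μ, h1, h2⟩ : ∃ μ, m * x + n * y = μ * x ∧ k * x + l * y = μ * y := by
    rw [wedgeForm] at h
    rcases hxy with h0 | h0
    · refine ⟨(m * x + n * y) / x, by field_simp, ?_⟩
      field_simp
      linear_combination h
    · refine ⟨(k * x + l * y) / y, ?_, by field_simp⟩
      field_simp
      linear_combination -h
  refine ⟨x • (v₁ + (m • w₁ + k • w₂)) + y • (v₂ + (n • w₁ + l • w₂)),
    mem_span_pair.2 ⟨1, μ, ?_⟩, mem_span_pair.2 ⟨x, y, rfl⟩, fun h0 => ?_⟩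
  · ext i
    simp only [Pi.add_apply, Pi.smul_apply, smul_eq_mul]
    linear_combination -(w₁ i * h1 + w₂ i * h2)
  · obtain ⟨hx, hy, -⟩ := comb_eq_zero_of_det2_ne_zero hD (a := x) (b := y) (c := m * x + n * y)
      (d := k * x + l * y) (by rw [← h0]; module)
    exact hxy.elim (fun h => h hx) fun h => h hy

theorem skew_transversals {v₁ v₂ w₁ w₂ : V4} (hD : det2 v₁ v₂ w₁ w₂ ≠ 0) {x y x' y' : ℝ}
    (h : x * y' - y * x' ≠ 0) : Skew (span ℝ {x • v₁ + y • v₂, x • w₁ + y • w₂})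
      (span ℝ {x' • v₁ + y' • v₂, x' • w₁ + y' • w₂}) := by
  apply skew_of_det2_ne_zero
  have h1 : det2 (x • v₁ + y • v₂) (x • w₁ + y • w₂) (x' • v₁ + y' • v₂) (x' • w₁ + y' • w₂) =
      -(det2 v₁ v₂ w₁ w₂ * (x * y' - y * x') ^ 2) := by
    simp only [det2_eq, Pi.add_apply, Pi.smul_apply, smul_eq_mul]
    ring
  rw [h1]
  exact neg_ne_zero.2 (mul_ne_zero hD (pow_ne_zero 2 h))

theorem exists_perm_apply_eq {α : Type*} [DecidableEq α] {a b c d : α} (hab : a ≠ b) (hcd : c ≠ d) :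
    ∃ π : Equiv.Perm α, π a = c ∧ π b = d := by
  refine ⟨Equiv.swap (Equiv.swap a c b) d * Equiv.swap a c, ?_, by simp⟩
  have h1 : Equiv.swap a c b ≠ c := fun h => hab (by
    rw [Equiv.swap_apply_eq_iff] at h
    simpa using h.symm)
  simp [Equiv.swap_apply_of_ne_of_ne h1.symm hcd]

theorem exists_pair_of_omissions : ∀ o : Fin 3 → Fin 3, ∃ i i' j j', i ≠ i' ∧ j ≠ j' ∧
    (∀ c, c ≠ j → i ≠ o c) ∧ ∀ c, c ≠ j' → i' ≠ o c := by
  decide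

theorem det2_graph_zero (v₁ v₂ w₁ w₂ : V4) (m n k l : ℝ) :
    det2 v₁ v₂ (v₁ + (m • w₁ + k • w₂)) (v₂ + (n • w₁ + l • w₂)) =
      det2 v₁ v₂ w₁ w₂ * (m * l - n * k) := by
  simpa using det2_graph v₁ v₂ w₁ w₂ 0 0 0 0 m n k l

theorem det2_graph_one (v₁ v₂ w₁ w₂ : V4) (m n k l : ℝ) :
    det2 (v₁ + w₁) (v₂ + w₂) (v₁ + (m • w₁ + k • w₂)) (v₂ + (n • w₁ + l • w₂)) =
      det2 v₁ v₂ w₁ w₂ * ((m - 1) * (l - 1) - n * k) := by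
  simpa using det2_graph v₁ v₂ w₁ w₂ 1 0 0 1 m n k l

theorem frameSign_of_eq_mul {f : Frames} {i j : Fin 6} {D p : ℝ} (h : frameDet f i j = D * p)
    (hp : 0 < p) : frameSign f i j = (SignType.sign D : ℤ) := by
  rw [frameSign, h, _root_.sign_mul, sign_pos hp, mul_one]

/-- Two graph matrices without real eigenvectors and with the same pencil of eigenvectors give
five lines with signature ten in absolute value. -/
theorem not_bipartiteSigns_of_disc_neg {f : Frames} {v₁ v₂ w₁ w₂ : V4} {m n k l m' n' k' l' : ℝ}
    (hf : f ∈ skewFrames) (h0 : f 0 = (v₁, v₂)) (h1 : f 1 = (w₁, w₂)) (h2 : f 2 = (v₁ + w₁, v₂ + w₂))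
    (h3 : f 3 = (v₁ + (m • w₁ + k • w₂), v₂ + (n • w₁ + l • w₂)))
    (h4 : f 4 = (v₁ + (m' • w₁ + k' • w₂), v₂ + (n' • w₁ + l' • w₂)))
    (hneg : (l - m) ^ 2 + 4 * k * n < 0) (hneg' : (l' - m') ^ 2 + 4 * k' * n' < 0)
    (hsub : 0 ≤ (m' - m) * (l' - l) - (n' - n) * (k' - k)) :
    ¬BipartiteSigns (frameSign f) := by
  obtain ⟨D, hD⟩ : ∃ D, D = det2 v₁ v₂ w₁ w₂ := ⟨_, rfl⟩
  have e01 : frameDet f 0 1 = D * 1 := by rw [frameDet, h0, h1, hD, mul_one]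
  have e02 : frameDet f 0 2 = D * 1 := by
    rw [frameDet, h0, h2, hD]
    simpa using det2_graph_zero v₁ v₂ w₁ w₂ 1 0 0 1
  have e03 : frameDet f 0 3 = D * (m * l - n * k) := by
    rw [frameDet, h0, h3, hD]
    exact det2_graph_zero ..
  have e04 : frameDet f 0 4 = D * (m' * l' - n' * k') := by
    rw [frameDet, h0, h4, hD]
    exact det2_graph_zero ..
  have e12 : frameDet f 1 2 = D * 1 := by
    rw [frameDet, h1, h2, hD]
    simpa using det2_graph_right v₁ v₂ w₁ w₂ 1 0 0 1
  have e13 : frameDet f 1 3 = D * 1 := by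
    rw [frameDet, h1, h3, hD, mul_one]
    exact det2_graph_right ..
  have e14 : frameDet f 1 4 = D * 1 := by
    rw [frameDet, h1, h4, hD, mul_one]
    exact det2_graph_right ..
  have e23 : frameDet f 2 3 = D * ((m - 1) * (l - 1) - n * k) := by
    rw [frameDet, h2, h3, hD]
    exact det2_graph_one ..
  have e24 : frameDet f 2 4 = D * ((m' - 1) * (l' - 1) - n' * k') := by
    rw [frameDet, h2, h4, hD]
    exact det2_graph_one ..
  have e34 : frameDet f 3 4 = D * ((m' - m) * (l' - l) - (n' - n) * (k' - k)) := by
    rw [frameDet, h3, h4, hD]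
    exact det2_graph ..
  have hD0 : D ≠ 0 := by simpa [e01] using hf 0 1 (by decide)
  have hsub' : 0 < (m' - m) * (l' - l) - (n' - n) * (k' - k) :=
    hsub.lt_of_ne fun h => hf 3 4 (by decide) (by rw [e34, ← h, mul_zero])
  have hdet : ∀ {m n k l : ℝ}, (l - m) ^ 2 + 4 * k * n < 0 → 0 < m * l - n * k := by
    intro m n k l h
    nlinarith [sq_nonneg (l + m)]
  have hdet' : ∀ {m n k l : ℝ}, (l - m) ^ 2 + 4 * k * n < 0 → 0 < (m - 1) * (l - 1) - n * k :=
    fun h => hdet (by linarith)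
  intro hb
  have h5 := (bipartiteSigns_iff (frameSign_symm f) (frameSign_self f)).1 hb 5
  simp only [show Fin.succAbove (5 : Fin 6) (0 : Fin 5) = 0 from rfl,
    show Fin.succAbove (5 : Fin 6) (1 : Fin 5) = 1 from rfl,
    show Fin.succAbove (5 : Fin 6) (2 : Fin 5) = 2 from rfl,
    show Fin.succAbove (5 : Fin 6) (3 : Fin 5) = 3 from rfl,
    show Fin.succAbove (5 : Fin 6) (4 : Fin 5) = 4 from rfl,
    frameSign_of_eq_mul e01 one_pos, frameSign_of_eq_mul e02 one_pos,
    frameSign_of_eq_mul e03 (hdet hneg), frameSign_of_eq_mul e04 (hdet hneg'),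
    frameSign_of_eq_mul e12 one_pos, frameSign_of_eq_mul e13 one_pos,
    frameSign_of_eq_mul e14 one_pos, frameSign_of_eq_mul e23 (hdet' hneg),
    frameSign_of_eq_mul e24 (hdet' hneg'), frameSign_of_eq_mul e34 hsub'] at h5
  rcases lt_or_gt_of_ne hD0 with h | h
  · rw [sign_neg h] at h5
    exact absurd h5 (by decide)
  · rw [sign_pos h] at h5
    exact absurd h5 (by decide)

theorem frameLines_mem_skewFrames {f : Frames} (h : PairwiseSkew (frameLines f)) :
    f ∈ skewFrames := fun i j hij => det2_ne_zero_of_skew (h i j hij)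

/-- A bipartite Schläfli six has two skew lines, each meeting all but one of its lines, such that
the two omitted lines are different. -/
theorem exists_transversals {L : Fin 6 → PLine} (hL : IsSchlafliSix L)
    (hsig : ∀ i : Fin 6, |sgnOf (L ∘ i.succAbove)| = 4) :
    ∃ (π : Equiv.Perm (Fin 6)) (A B : PLine), Skew A B ∧
      (∀ i, i ≠ 5 → ∃ a ∈ A, a ∈ L (π i) ∧ a ≠ 0) ∧
      ∀ i, i ≠ 0 → ∃ b ∈ B, b ∈ L (π i) ∧ b ≠ 0 := by
  obtain ⟨hskew, F, -, hF, hvan, hsm⟩ := hL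
  obtain ⟨T, hT1, hT2, hT3, hTsm⟩ := exists_polarization hF hsm
  obtain ⟨v₁, v₂, w₁, w₂, m, n, k, l, hD, hL0, hL1, hL2, hLj⟩ := exists_graph_coordinates hskew
  have hzero : ∀ i, ∀ z ∈ L i, T z z z = 0 := fun i z hz => by rw [hT3, hvan i z hz, mul_zero]
  obtain ⟨P, Q, R, S, hs, hPQ⟩ := exists_smoothBicubic hT1 hT2 hTsm hD (hL0 ▸ hzero 0)
    (hL1 ▸ hzero 1)
  have hd : ∀ a b, bicubic P Q R S a b a b = 0 := by
    intro a b
    have h := hPQ a b a b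
    rw [hzero 2 _ (hL2 ▸ mem_span_pair.2 ⟨a, b, by module⟩)] at h
    linarith
  have hj : ∀ j a b, bicubic P Q R S a b (m j * a + n j * b) (k j * a + l j * b) = 0 := by
    intro j a b
    have h := hPQ a b (m j * a + n j * b) (k j * a + l j * b)
    rw [hzero (Fin.natAdd 3 j) _ (hLj j ▸ mem_span_pair.2 ⟨a, b, by module⟩)] at h
    linarith
  have hdet : ∀ j, m j * l j - n j * k j ≠ 0 := by
    intro j h
    have := det2_ne_zero_of_skew
      (hL0 ▸ hLj j ▸ hskew 0 (Fin.natAdd 3 j) (by fin_cases j <;> decide))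
    rw [det2_graph_zero, h, mul_zero] at this
    exact this rfl
  have hdet' : ∀ j, (m j - 1) * (l j - 1) - n j * k j ≠ 0 := by
    intro j h
    have := det2_ne_zero_of_skew
      (hL2 ▸ hLj j ▸ hskew 2 (Fin.natAdd 3 j) (by fin_cases j <;> decide))
    rw [det2_graph_one, h, mul_zero] at this
    exact this rfl
  choose s t hst using fun j => exists_wedgeForm_dvd_diagCubic hd (hj j) (hdet j) (hdet' j)
  have hfac := fun j => diagFactor_of_forall (hst j)
  by_cases hpos : ∃ j, 0 < (l j - m j) ^ 2 + 4 * k j * n j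
  · obtain ⟨j₀, hj₀⟩ := hpos
    obtain ⟨x, y, hxy, ho⟩ := exists_three_zeros hs hd hfac hj₀
    choose o ho using ho
    have hne : ∀ i, x i ≠ 0 ∨ y i ≠ 0 := by
      intro i
      obtain ⟨i', hi'⟩ := exists_ne i
      by_contra! hc
      exact hxy i i' hi'.symm (by rw [hc.1, hc.2]; ring)
    have hmeet : ∀ i j, (∀ c, c ≠ j → i ≠ o c) → ∀ q, q ≠ Fin.natAdd 3 j →
        ∃ a ∈ span ℝ {x i • v₁ + y i • v₂, x i • w₁ + y i • w₂}, a ∈ L q ∧ a ≠ 0 := by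
      intro i j hi q
      have hv : x i • v₁ + y i • v₂ ≠ 0 := fun h => by
        obtain ⟨hx, hy, -⟩ := comb_eq_zero_of_det2_ne_zero hD (a := x i) (b := y i) (c := 0) (d := 0)
          (by rw [h]; simp)
        exact (hne i).elim (fun h => h hx) fun h => h hy
      have hw : x i • w₁ + y i • w₂ ≠ 0 := fun h => by
        obtain ⟨-, -, hx, hy⟩ := comb_eq_zero_of_det2_ne_zero hD (a := 0) (b := 0) (c := x i) (d := y i)
          (by rw [h]; simp)
        exact (hne i).elim (fun h => h hx) fun h => h hy
      refine Fin.addCases (m := 3) (n := 3) (fun q _ => ?_) (fun q hq => ?_) q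
      · fin_cases q
        · exact ⟨_, subset_span (by simp), hL0 ▸ mem_span_pair.2 ⟨x i, y i, rfl⟩, hv⟩
        · exact ⟨_, subset_span (Set.mem_insert_of_mem _ rfl),
            hL1 ▸ mem_span_pair.2 ⟨x i, y i, rfl⟩, hw⟩
        · refine ⟨_, mem_span_pair.2 ⟨1, 1, rfl⟩, hL2 ▸ mem_span_pair.2 ⟨x i, y i, ?_⟩, fun h => ?_⟩
          · module
          · obtain ⟨hx, hy, -⟩ := comb_eq_zero_of_det2_ne_zero hD (a := x i) (b := y i) (c := x i)
              (d := y i) (by rw [← h]; module)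
            exact (hne i).elim (fun h => h hx) fun h => h hy
      · rw [hLj]
        exact exists_mem_transversal hD (hne i)
          (ho q i (hi q fun h => hq (by rw [h])))
    obtain ⟨i, i', j, j', hii', hjj', hi, hi'⟩ := exists_pair_of_omissions o
    obtain ⟨π, hπ5, hπ0⟩ := exists_perm_apply_eq (show (5 : Fin 6) ≠ 0 by decide)
      ((Fin.natAdd_injective 3 3).ne hjj')
    refine ⟨π, _, _, skew_transversals hD (hxy i i' hii'), fun q hq => hmeet i j hi _ ?_,
      fun q hq => hmeet i' j' hi' _ ?_⟩
    · rw [← hπ5]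
      exact π.injective.ne hq
    · rw [← hπ0]
      exact π.injective.ne hq
  · push Not at hpos
    have hneg : ∀ j, (l j - m j) ^ 2 + 4 * k j * n j < 0 := fun j =>
      (hpos j).lt_of_ne ((hfac j).disc_ne_zero hs hd)
    obtain ⟨c, hk, he, hn⟩ := exists_eq_mul_of_disc_neg hs hd (hfac 0) (hfac 1) (hneg 0)
    obtain ⟨f, hf⟩ : ∃ f : Frames, f = ![(v₁, v₂), (w₁, w₂), (v₁ + w₁, v₂ + w₂),
      (v₁ + (m 0 • w₁ + k 0 • w₂), v₂ + (n 0 • w₁ + l 0 • w₂)),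
      (v₁ + (m 1 • w₁ + k 1 • w₂), v₂ + (n 1 • w₁ + l 1 • w₂)),
      (v₁ + (m 2 • w₁ + k 2 • w₂), v₂ + (n 2 • w₁ + l 2 • w₂))] := ⟨_, rfl⟩
    have hLf : L = frameLines f := by
      subst hf
      funext q
      fin_cases q
      exacts [hL0, hL1, hL2, hLj 0, hLj 1, hLj 2]
    have hfs : f ∈ skewFrames := frameLines_mem_skewFrames (hLf ▸ hskew)
    refine absurd (bipartiteSigns_of_sgnOf hfs (hLf ▸ hsig)) (not_bipartiteSigns_of_disc_neg hfs
      (by subst hf; rfl) (by subst hf; rfl) (by subst hf; rfl) (by subst hf; rfl) (by subst hf; rfl)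
      (hneg 0) (hneg 1) (det_sub_nonneg_of_disc_neg (hneg 0) hk he hn))

theorem bipartiteSigns_of_frameLines_eq {f g : Frames} (hf : f ∈ skewFrames)
    (h : frameLines f = frameLines g) (hb : BipartiteSigns (frameSign g)) :
    BipartiteSigns (frameSign f) := by
  choose c hc using fun i => exists_det2_eq_mul (congrFun h i).symm
  have h1 : ∀ i j, frameDet f i j = c i * c j * frameDet g i j := by
    intro i j
    rw [frameDet, (hc i _ _).1, (hc j _ _).2, frameDet, mul_assoc]
  have hc0 : ∀ i, c i ≠ 0 := by
    intro i hi
    obtain ⟨j, hj⟩ := exists_ne i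
    exact hf i j hj.symm (by rw [h1, hi]; ring)
  refine BipartiteSigns.of_switch (fun i => (SignType.sign (c i) : ℤ)) (fun i => ?_)
    (fun i j => ?_) hb
  · exact sign_cast_mul_self (hc0 i)
  · rw [frameSign, h1, _root_.sign_mul, _root_.sign_mul, frameSign]
    push_cast
    rfl

theorem schlafli_bipartite_J123654 (L : Fin 6 → PLine) (hL : IsSchlafliSix L)
    (hsig : ∀ i : Fin 6, |sgnOf (L ∘ i.succAbove)| = 4) :
    DeformEquiv L (joinConfig (Equiv.swap (3 : Fin 6) 5)) := by
  obtain ⟨π, A, B, hAB, hA, hB⟩ := exists_transversals hL hsig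
  have hskew : PairwiseSkew (L ∘ π) := fun i j hij => hL.1 _ _ (π.injective.ne hij)
  obtain ⟨M, y₀, s, z₀, x, y, z, w, t, t', hM, hLf⟩ := exists_transversalFrames hskew hAB hA hB
  obtain ⟨g, hg, rfl⟩ := exists_frames hL.1
  have hf := frameLines_mem_skewFrames (hLf ▸ hskew)
  have hb := bipartiteSigns_of_frameLines_eq (g := g ∘ π) hf hLf.symm
    ((bipartiteSigns_of_sgnOf hg hsig).comp π)
  refine DeformEquiv.of_comp_perm π ?_
  rw [hLf, ← frameLines_permFrames]
  exact (actFrames_transversalFrames_equiv hM hf hb).deformEquiv
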